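/- For every g ∈ GL_n(F_q), the image of the subspace g·V^U under the quotient map V → V_{N̄} is nonzero if and only if g ∈ P̄·P_V. -/

import Mathlib

open Matrix

namespace GLRep

section Elementary

variable {ι F : Type*} [Fintype ι] [DecidableEq ι] [Field F]

/-- The transvection `1 + t E_ab` as an invertible matrix (the identity when `a = b`). -/
def elem (a b : ι) (t : F) : GL ι F :=
  if h : a = b then 1 else
    ⟨transvection a b t, transvection a b (-t),
      by rw [transvection_mul_transvection_same _ _ h]; simp,
      by rw [transvection_mul_transvection_same _ _ h]; simp⟩

/-- The permutation matrix sending the basis vector `e_j` to `e_(σ j)`. -/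
def perm : Equiv.Perm ι →* GL ι F :=
  MonoidHom.toHomUnits
    { toFun := fun σ => Matrix.of fun i j => if i = σ j then (1 : F) else 0
      map_one' := by ext i j; simp [Matrix.one_apply]; congr
      map_mul' := by intro σ τ; ext i j; simp [Matrix.mul_apply]; congr }

/-- The diagonal torus. -/
def diag : (ι → Fˣ) →* GL ι F :=
  MonoidHom.toHomUnits
    { toFun := fun d => Matrix.diagonal fun i => (d i : F)
      map_one' := by simp
      map_mul' := by intro d e; simp }

theorem coe_elem {a b : ι} (h : a ≠ b) (t : F) :
    (elem a b t : GL ι F).val = transvection a b t := by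
  simp [elem, h]

theorem perm_apply (σ : Equiv.Perm ι) (i j : ι) :
    (perm σ : GL ι F).val i j = if i = σ j then 1 else 0 := rfl

theorem coe_diag (d : ι → Fˣ) : (diag d : GL ι F).val = Matrix.diagonal fun i => (d i : F) := rfl

theorem elem_mul_apply {a b : ι} (h : a ≠ b) (t : F) (g : GL ι F) (i j : ι) :
    (elem a b t * g).val i j = g.val i j + if i = a then t * g.val b j else 0 := by
  rw [Units.val_mul, coe_elem h]
  split_ifs with hi
  · subst hi; simp
  · simp [hi]

theorem mul_elem_apply {a b : ι} (h : a ≠ b) (t : F) (g : GL ι F) (i j : ι) :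
    (g * elem a b t).val i j = g.val i j + if j = b then t * g.val i a else 0 := by
  rw [Units.val_mul, coe_elem h]
  split_ifs with hi
  · subst hi; simp
  · simp [hi]

theorem perm_mul_apply (σ : Equiv.Perm ι) (g : GL ι F) (i j : ι) :
    (perm σ * g).val i j = g.val (σ⁻¹ i) j := by
  rw [Units.val_mul, Matrix.mul_apply]
  simp only [perm_apply, ite_mul, one_mul, zero_mul]
  rw [Finset.sum_eq_single (σ⁻¹ i)]
  · simp
  · intro k _ hk
    rw [if_neg]
    rintro rfl
    simp at hk
  · simp

theorem mul_perm_apply (σ : Equiv.Perm ι) (g : GL ι F) (i j : ι) :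
    (g * perm σ).val i j = g.val i (σ j) := by
  rw [Units.val_mul, Matrix.mul_apply]
  simp [perm_apply]

theorem diag_mul_apply (d : ι → Fˣ) (g : GL ι F) (i j : ι) :
    (diag d * g).val i j = d i * g.val i j := by
  rw [Units.val_mul, coe_diag, Matrix.diagonal_mul]

theorem mul_diag_apply (d : ι → Fˣ) (g : GL ι F) (i j : ι) :
    (g * diag d).val i j = g.val i j * d j := by
  rw [Units.val_mul, coe_diag, Matrix.mul_diagonal]

theorem elem_apply {a b : ι} (h : a ≠ b) (t : F) (i j : ι) :
    (elem a b t : GL ι F).val i j = (if i = j then 1 else 0) + if i = a ∧ j = b then t else 0 := by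
  rw [coe_elem h, transvection, Matrix.add_apply, Matrix.one_apply, Matrix.single_apply]
  grind

theorem elem_zero (a b : ι) : (elem a b 0 : GL ι F) = 1 := by
  unfold elem
  split_ifs
  · rfl
  · ext; simp

theorem elem_mul_elem_same (a b : ι) (s t : F) :
    (elem a b s * elem a b t : GL ι F) = elem a b (s + t) := by
  by_cases h : a = b
  · simp [elem, h]
  · ext i j
    rw [elem_mul_apply h, elem_apply h, elem_apply h, elem_apply h]
    grind

theorem elem_comm {a b c d : ι} (hab : a ≠ b) (hcd : c ≠ d) (hbc : b ≠ c) (had : a ≠ d)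
    (s t : F) : (elem a b s * elem c d t : GL ι F) = elem c d t * elem a b s := by
  ext i j
  rw [elem_mul_apply hab, elem_mul_apply hcd, elem_apply hab, elem_apply hab,
    elem_apply hcd, elem_apply hcd]
  grind

theorem elem_comm_heisenberg {a b c : ι} (hab : a ≠ b) (hbc : b ≠ c) (hac : a ≠ c) (s t : F) :
    (elem a b s * elem b c t : GL ι F) = elem b c t * elem a b s * elem a c (s * t) := by
  ext i j
  rw [elem_mul_apply hab, mul_elem_apply hac, elem_mul_apply hbc, elem_mul_apply hbc,
    elem_apply hab, elem_apply hab, elem_apply hab, elem_apply hab,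
    elem_apply hbc, elem_apply hbc]
  grind

theorem perm_mul_elem (σ : Equiv.Perm ι) (a b : ι) (t : F) :
    (perm σ * elem a b t : GL ι F) = elem (σ a) (σ b) t * perm σ := by
  by_cases h : a = b
  · simp [elem, h]
  · ext i j
    rw [perm_mul_apply, mul_perm_apply, elem_apply h, elem_apply (by simpa using h)]
    simp only [Equiv.Perm.inv_eq_iff_eq, EmbeddingLike.apply_eq_iff_eq]

theorem diag_mul_elem (d : ι → Fˣ) (a b : ι) (t : F) :
    (diag d * elem a b t : GL ι F) = elem a b (d a * t * (d b)⁻¹) * diag d := by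
  by_cases h : a = b
  · simp [elem, h]
  · ext i j
    rw [diag_mul_apply, mul_diag_apply, elem_apply h, elem_apply h]
    by_cases h1 : i = j
    · subst h1
      grind
    · by_cases h2 : i = a ∧ j = b
      · obtain ⟨rfl, rfl⟩ := h2
        simp [h1]
      · simp [h1, h2]

theorem diag_mul_perm (d : ι → Fˣ) (σ : Equiv.Perm ι) :
    (diag d * perm σ : GL ι F) = perm σ * diag (d ∘ σ) := by
  ext i j
  rw [diag_mul_apply, mul_diag_apply, perm_apply]
  split_ifs with h
  · subst h; simp
  · simp

/-- The diagonal element occurring in the rank-one Bruhat decomposition of `elem b a t`. -/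
def coroot (a b : ι) (t : Fˣ) : ι → Fˣ :=
  Function.update (Function.update 1 b t) a (-t⁻¹)

theorem elem_swap {a b : ι} (h : a ≠ b) (t : Fˣ) :
    (elem b a (t : F) : GL ι F) =
      elem a b ((t⁻¹ : Fˣ) : F) * (diag (coroot a b t) * perm (Equiv.swap a b)) *
        elem a b ((t⁻¹ : Fˣ) : F) := by
  have h' : b ≠ a := h.symm
  ext i j
  simp only [mul_elem_apply h, elem_mul_apply h, diag_mul_apply, perm_apply, elem_apply h.symm,
    coroot, Function.update_apply, Equiv.swap_apply_def]
  simp only [Units.val_inv_eq_inv_val]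
  by_cases h1 : i = a <;> by_cases h2 : i = b <;> by_cases h3 : j = a <;> by_cases h4 : j = b <;>
    simp_all
  all_goals grind

theorem swap_mul_elem (a b : ι) (t : F) :
    (perm (Equiv.swap a b) * elem a b t : GL ι F) = elem b a t * perm (Equiv.swap a b) := by
  rw [perm_mul_elem]; simp

theorem swap_mul_swap (a b : ι) :
    (perm (Equiv.swap a b) * perm (Equiv.swap a b) : GL ι F) = 1 := by
  rw [← map_mul]; simp

end Elementary

section Parabolic

variable {ι F α : Type*} [Fintype ι] [Field F] [LinearOrder α]

theorem mul_apply_congr_left {b : ι → α} {x y k : Matrix ι ι F}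
    (hxy : ∀ i j, b j ≤ b i → x i j = y i j) (hk : k.BlockTriangular b) {i j : ι}
    (hij : b j ≤ b i) : (x * k) i j = (y * k) i j := by
  rw [Matrix.mul_apply, Matrix.mul_apply]
  refine Finset.sum_congr rfl fun l _ => ?_
  by_cases hl : b l ≤ b i
  · rw [hxy i l hl]
  · rw [hk (lt_of_le_of_lt hij (not_le.mp hl)), mul_zero, mul_zero]

theorem mul_apply_congr_right {b : ι → α} {x y k : Matrix ι ι F}
    (hxy : ∀ i j, b j ≤ b i → x i j = y i j) (hk : k.BlockTriangular b) {i j : ι}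
    (hij : b j ≤ b i) : (k * x) i j = (k * y) i j := by
  rw [Matrix.mul_apply, Matrix.mul_apply]
  refine Finset.sum_congr rfl fun l _ => ?_
  by_cases hl : b j ≤ b l
  · rw [hxy l j hl]
  · rw [hk (lt_of_lt_of_le (not_le.mp hl) hij), zero_mul, zero_mul]

/-- The block diagonal part of a block triangular matrix. -/
def blockDiag (b : ι → α) (g : Matrix ι ι F) : Matrix ι ι F :=
  Matrix.of fun i j => if b i = b j then g i j else 0

theorem blockDiag_mul {b : ι → α} {g h : Matrix ι ι F} (hg : g.BlockTriangular b)
    (hh : h.BlockTriangular b) : blockDiag b g * blockDiag b h = blockDiag b (g * h) := by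
  ext i j
  simp only [blockDiag, Matrix.mul_apply, Matrix.of_apply]
  by_cases hij : b i = b j
  · rw [if_pos hij]
    refine Finset.sum_congr rfl fun l _ => ?_
    rcases lt_trichotomy (b i) (b l) with h1 | h1 | h1
    · rw [if_neg h1.ne, hh (hij ▸ h1)]; simp
    · rw [if_pos h1, if_pos (h1 ▸ hij)]
    · rw [if_neg h1.ne', hg h1]; simp
  · rw [if_neg hij]
    refine Finset.sum_eq_zero fun l _ => ?_
    by_cases h1 : b i = b l
    · rw [if_neg (fun h2 => hij (h1.trans h2)), mul_zero]
    · rw [if_neg h1, zero_mul]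

theorem blockDiag_one {ι F α : Type*} [DecidableEq ι] [Field F] [LinearOrder α] (b : ι → α) :
    blockDiag b (1 : Matrix ι ι F) = 1 := by
  ext i j
  simp only [blockDiag, Matrix.of_apply, Matrix.one_apply]
  grind

variable [DecidableEq ι]

/-- The parabolic subgroup of block triangular matrices attached to `b`. -/
def parabolic (b : ι → α) : Subgroup (GL ι F) where
  carrier := {g | g.val.BlockTriangular b}
  one_mem' := blockTriangular_one
  mul_mem' hg hh := Matrix.BlockTriangular.mul hg hh
  inv_mem' {g} hg := by
    change (g⁻¹).val.BlockTriangular b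
    rw [Matrix.coe_units_inv]
    have := g.invertible
    exact blockTriangular_inv_of_blockTriangular hg

/-- The unipotent radical of `parabolic b`. -/
def unirad (b : ι → α) : Subgroup (GL ι F) where
  carrier := {g | ∀ i j, b j ≤ b i → g.val i j = (1 : Matrix ι ι F) i j}
  one_mem' i j _ := rfl
  mul_mem' {g h} hg hh := fun i j hij => by
    have hb : h.val.BlockTriangular b := fun i j hij => by
      rw [hh i j hij.le, Matrix.one_apply_ne]
      rintro rfl
      exact hij.false
    rw [Units.val_mul, mul_apply_congr_left hg hb hij, one_mul, hh i j hij]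
  inv_mem' {g} hg := fun i j hij => by
    have hb : g ∈ parabolic b := fun i j hij => by
      rw [hg i j hij.le, Matrix.one_apply_ne]
      rintro rfl
      exact hij.false
    have h := mul_apply_congr_left hg ((parabolic b).inv_mem hb) hij
    rw [one_mul, ← Units.val_mul, mul_inv_cancel] at h
    exact h.symm

theorem mem_unirad {b : ι → α} {g : GL ι F} :
    g ∈ unirad b ↔ ∀ i j, b j ≤ b i → g.val i j = (1 : Matrix ι ι F) i j := Iff.rfl

theorem unirad_le_parabolic (b : ι → α) : (unirad b : Subgroup (GL ι F)) ≤ parabolic b :=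
  fun g hg i j hij => by
    rw [hg i j hij.le, Matrix.one_apply_ne]
    rintro rfl
    exact hij.false

theorem conj_mem_unirad {b : ι → α} {g h : GL ι F} (hg : g ∈ unirad b) (hh : h ∈ parabolic b) :
    h * g * h⁻¹ ∈ unirad b := fun i j hij => by
  have h1 : ∀ i j, b j ≤ b i → (h * g).val i j = h.val i j := fun i j hij => by
    rw [Units.val_mul, mul_apply_congr_right hg hh hij, mul_one]
  rw [Units.val_mul, mul_apply_congr_left h1 ((parabolic b).inv_mem hh) hij, ← Units.val_mul,
    mul_inv_cancel, Units.val_one]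

theorem unirad_mono {β : Type*} [LinearOrder β] {b : ι → α} {c : ι → β}
    (h : ∀ i j, c j ≤ c i → b j ≤ b i) : (unirad b : Subgroup (GL ι F)) ≤ unirad c :=
  fun _ hg i j hij => hg i j (h i j hij)

theorem parabolic_mono {β : Type*} [LinearOrder β] {b : ι → α} {c : ι → β}
    (h : ∀ i j, c j < c i → b j < b i) : (parabolic b : Subgroup (GL ι F)) ≤ parabolic c :=
  fun _ hg i j hij => hg (h i j hij)

theorem diag_mem_parabolic (b : ι → α) (d : ι → Fˣ) : (diag d : GL ι F) ∈ parabolic b :=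
  blockTriangular_diagonal _

theorem elem_mem_unirad {b : ι → α} {i j : ι} (h : b i < b j) (t : F) :
    elem i j t ∈ unirad b := fun k l hkl => by
  have hij : i ≠ j := by rintro rfl; exact h.false
  have h' : ¬(k = i ∧ l = j) := by
    rintro ⟨rfl, rfl⟩
    exact (h.trans_le hkl).false
  rw [elem_apply hij, Matrix.one_apply, if_neg h', add_zero]

/-- The Levi decomposition. -/
theorem exists_levi_mul_unirad {b : ι → α} {g : GL ι F} (hg : g ∈ parabolic b) :
    ∃ m u : GL ι F, (∀ i j, b i ≠ b j → m.val i j = 0) ∧ u ∈ unirad b ∧ g = m * u := by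
  have hg' := (parabolic b).inv_mem hg
  let m : GL ι F := ⟨blockDiag b g.val, blockDiag b (g⁻¹).val,
    by rw [blockDiag_mul hg hg', ← Units.val_mul, mul_inv_cancel, Units.val_one, blockDiag_one],
    by rw [blockDiag_mul hg' hg, ← Units.val_mul, inv_mul_cancel, Units.val_one, blockDiag_one]⟩
  have hm : ∀ i j, b i ≠ b j → m.val i j = 0 := fun i j hij => if_neg hij
  have hmp : m ∈ parabolic b := fun i j hij => hm i j hij.ne'
  refine ⟨m, m⁻¹ * g, hm, fun i j hij => ?_, by group⟩
  have h1 : ∀ i j, b j ≤ b i → g.val i j = m.val i j := fun i j hij => by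
    rcases hij.eq_or_lt with h | h
    · exact (if_pos h.symm).symm
    · rw [hg h, hmp h]
  rw [Units.val_mul, mul_apply_congr_right h1 ((parabolic b).inv_mem hmp) hij, ← Units.val_mul,
    inv_mul_cancel, Units.val_one]

/-- The transpose of an invertible matrix. -/
def tr (g : GL ι F) : GL ι F :=
  ⟨g.valᵀ, (g⁻¹).valᵀ, by rw [← Matrix.transpose_mul, ← Units.val_mul]; simp,
    by rw [← Matrix.transpose_mul, ← Units.val_mul]; simp⟩

theorem tr_apply (g : GL ι F) (i j : ι) : (tr g).val i j = g.val j i := rfl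

theorem tr_mul (g h : GL ι F) : tr (g * h) = tr h * tr g :=
  Units.ext (Matrix.transpose_mul _ _)

theorem tr_one : tr (1 : GL ι F) = 1 := Units.ext Matrix.transpose_one

theorem tr_tr (g : GL ι F) : tr (tr g) = g := Units.ext (Matrix.transpose_transpose _)

theorem tr_mem_unirad {b : ι → α} {g : GL ι F} :
    tr g ∈ unirad b ↔ g ∈ unirad (fun i => OrderDual.toDual (b i)) := by
  simp only [mem_unirad, tr_apply, OrderDual.toDual_le_toDual]
  constructor <;> intro h i j hij <;> rw [h j i hij, Matrix.one_apply, Matrix.one_apply] <;> grind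

end Parabolic

section Simple

variable {n : ℕ} {F : Type*} [Field F]

/-- The upper unitriangular subgroup. -/
abbrev upper (n : ℕ) (F : Type*) [Field F] : Subgroup (GL (Fin n) F) :=
  unirad (fun i : Fin n => i)

/-- The lower unitriangular subgroup. -/
abbrev lower (n : ℕ) (F : Type*) [Field F] : Subgroup (GL (Fin n) F) :=
  unirad (fun i : Fin n => OrderDual.toDual i)

theorem elem_mem_upper {i j : Fin n} (h : i < j) (t : F) : elem i j t ∈ upper n F :=
  elem_mem_unirad (b := fun i : Fin n => i) h t

theorem elem_mem_lower {i j : Fin n} (h : i < j) (t : F) : elem j i t ∈ lower n F :=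
  elem_mem_unirad (b := fun i : Fin n => OrderDual.toDual i) (OrderDual.toDual_lt_toDual.mpr h) t

theorem upper_apply_self {g : GL (Fin n) F} (hg : g ∈ upper n F) (i : Fin n) :
    g.val i i = 1 := by simpa using hg i i le_rfl

theorem lower_apply_self {g : GL (Fin n) F} (hg : g ∈ lower n F) (i : Fin n) :
    g.val i i = 1 := by simpa using hg i i le_rfl

theorem swap_le_swap {a b i j : Fin n} (hab : a.val + 1 = b.val) (hij : j ≤ i)
    (h : ¬ (j = a ∧ i = b)) : Equiv.swap a b j ≤ Equiv.swap a b i := by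
  simp only [Equiv.swap_apply_def]
  grind

theorem conj_swap_apply (a b : Fin n) (g : GL (Fin n) F) (i j : Fin n) :
    (perm (Equiv.swap a b) * g * perm (Equiv.swap a b)).val i j =
      g.val (Equiv.swap a b i) (Equiv.swap a b j) := by
  rw [mul_perm_apply, perm_mul_apply, Equiv.swap_inv]

theorem conj_swap_mem_upper {a b : Fin n} (hab : a.val + 1 = b.val) {g : GL (Fin n) F}
    (hg : g ∈ upper n F) (h0 : g.val a b = 0) :
    perm (Equiv.swap a b) * g * perm (Equiv.swap a b) ∈ upper n F := fun i j hij => by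
  rw [conj_swap_apply]
  by_cases h : j = a ∧ i = b
  · obtain ⟨rfl, rfl⟩ := h
    rw [Equiv.swap_apply_left, Equiv.swap_apply_right, h0, Matrix.one_apply_ne]
    rintro rfl
    simp at hab
  · rw [hg _ _ (swap_le_swap hab hij h), Matrix.one_apply, Matrix.one_apply]
    simp

theorem conj_swap_mem_lower {a b : Fin n} (hab : a.val + 1 = b.val) {g : GL (Fin n) F}
    (hg : g ∈ lower n F) (h0 : g.val b a = 0) :
    perm (Equiv.swap a b) * g * perm (Equiv.swap a b) ∈ lower n F := fun i j hij => by
  rw [conj_swap_apply]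
  by_cases h : i = a ∧ j = b
  · obtain ⟨rfl, rfl⟩ := h
    rw [Equiv.swap_apply_left, Equiv.swap_apply_right, h0, Matrix.one_apply_ne]
    rintro rfl
    simp at hab
  · have h' := swap_le_swap hab (OrderDual.toDual_le_toDual.mp hij) h
    rw [hg _ _ (OrderDual.toDual_le_toDual.mpr h'),
      Matrix.one_apply, Matrix.one_apply]
    simp

/-- Every lower unitriangular matrix factors as an element normalised into the lower
unitriangular group by a simple reflection, times a simple root element. -/
theorem exists_lower_factor {a b : Fin n} (hab : a.val + 1 = b.val) {g : GL (Fin n) F}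
    (hg : g ∈ lower n F) : ∃ (h : GL (Fin n) F) (t : F), h ∈ lower n F ∧
      perm (Equiv.swap a b) * h * perm (Equiv.swap a b) ∈ lower n F ∧ g = h * elem b a t := by
  have hne : b ≠ a := by rintro rfl; simp at hab
  have hlt : a < b := by rw [Fin.lt_def]; omega
  have h1 : g * elem b a (-(g.val b a)) ∈ lower n F :=
    mul_mem hg (elem_mem_lower hlt _)
  refine ⟨g * elem b a (-(g.val b a)), g.val b a, h1, conj_swap_mem_lower hab h1 ?_, ?_⟩
  · rw [mul_elem_apply hne, lower_apply_self hg]; simp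
  · rw [mul_assoc, elem_mul_elem_same, neg_add_cancel, elem_zero, mul_one]

theorem upper_mul_elem {a b : Fin n} (hab : a.val + 1 = b.val) {g : GL (Fin n) F}
    (hg : g ∈ upper n F) (t : F) : ∃ h : GL (Fin n) F,
      perm (Equiv.swap a b) * h * perm (Equiv.swap a b) ∈ upper n F ∧
        g * elem a b t = elem a b (t + g.val a b) * h := by
  have hne : a ≠ b := by rintro rfl; simp at hab
  have hlt : a < b := by rw [Fin.lt_def]; omega
  have h1 : elem a b (-(t + g.val a b)) * (g * elem a b t) ∈ upper n F :=
    mul_mem (elem_mem_upper hlt _) (mul_mem hg (elem_mem_upper hlt _))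
  refine ⟨elem a b (-(t + g.val a b)) * (g * elem a b t), conj_swap_mem_upper hab h1 ?_, ?_⟩
  · rw [elem_mul_apply hne, mul_elem_apply hne, mul_elem_apply hne, upper_apply_self hg,
      upper_apply_self hg, hg b a hlt.le, Matrix.one_apply_ne hne.symm]
    simp
    ring
  · rw [← mul_assoc, elem_mul_elem_same, add_neg_cancel, elem_zero, one_mul]

end Simple

section Bruhat

variable {n : ℕ} {F : Type*} [Field F]

theorem mem_of_swap_mem {K : Submonoid (GL (Fin n) F)}
    (hswap : ∀ a b : Fin n, a.val + 1 = b.val → perm (Equiv.swap a b) ∈ K)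
    (σ : Equiv.Perm (Fin n)) : perm σ ∈ K := by
  cases n with
  | zero => rw [Subsingleton.elim σ 1, map_one]; exact K.one_mem
  | succ m =>
    have h : Submonoid.closure (Set.range fun i : Fin m ↦ Equiv.swap i.castSucc i.succ) ≤
        K.comap perm := by
      rw [Submonoid.closure_le]
      rintro _ ⟨i, rfl⟩
      exact hswap _ _ (by simp)
    rw [Equiv.Perm.mclosure_swap_castSucc_succ] at h
    exact h (Submonoid.mem_top σ)

/-- `GL_n` is generated by the lower unitriangular matrices, the diagonal matrices, and the
simple reflections. -/
theorem gl_mem_of_generators {K : Submonoid (GL (Fin n) F)}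
    (hlow : ∀ u ∈ lower n F, u ∈ K) (hdiag : ∀ d, diag d ∈ K)
    (hswap : ∀ a b : Fin n, a.val + 1 = b.val → perm (Equiv.swap a b) ∈ K)
    (g : GL (Fin n) F) : g ∈ K := by
  have key : ∀ x : GL (Fin n) F, x.val = g.val → x ∈ K := by
    refine diagonal_transvection_induction_of_det_ne_zero
      (fun M => ∀ x : GL (Fin n) F, x.val = M → x ∈ K) g.val
      (GeneralLinearGroup.det_ne_zero g) ?_ ?_ ?_
    · intro D hD x hx
      rw [Matrix.det_diagonal, Finset.prod_ne_zero_iff] at hD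
      have : x = diag fun i => Units.mk0 (D i) (hD i (Finset.mem_univ i)) := by
        apply Units.ext
        rw [hx, coe_diag]
        rfl
      exact this ▸ hdiag _
    · rintro ⟨i, j, hij, c⟩ x hx
      have hx' : x = elem i j c := by
        apply Units.ext
        rw [hx, coe_elem hij]
        rfl
      rw [hx']
      have hdown : ∀ i j : Fin n, i < j → elem j i c ∈ K := fun i j h =>
        hlow _ (elem_mem_lower h _)
      rcases lt_or_gt_of_ne hij with h | h
      · have h1 : (elem i j c : GL (Fin n) F) =
            perm (Equiv.swap i j) * elem j i c * perm (Equiv.swap i j) := by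
          rw [perm_mul_elem, mul_assoc, swap_mul_swap, mul_one]; simp
        rw [h1]
        exact mul_mem (mul_mem (mem_of_swap_mem hswap _) (hdown i j h)) (mem_of_swap_mem hswap _)
      · exact hdown j i h
    · intro A B hA hB ihA ihB x hx
      have : x = GeneralLinearGroup.mkOfDetNeZero A hA * GeneralLinearGroup.mkOfDetNeZero B hB :=
        Units.ext hx
      rw [this]
      exact mul_mem (ihA _ rfl) (ihB _ rfl)
  exact key g rfl

theorem gl_induction {P : GL (Fin n) F → Prop} (one : P 1)
    (low : ∀ u ∈ lower n F, ∀ g, P g → P (u * g)) (hdiag : ∀ d g, P g → P (diag d * g))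
    (swap : ∀ a b : Fin n, a.val + 1 = b.val → ∀ g, P g → P (perm (Equiv.swap a b) * g))
    (g : GL (Fin n) F) : P g := by
  let K : Submonoid (GL (Fin n) F) :=
    { carrier := {x | ∀ g, P g → P (x * g)}
      one_mem' := fun g hg => by rwa [one_mul]
      mul_mem' := fun {x y} hx hy g hg => by rw [mul_assoc]; exact hx _ (hy _ hg) }
  have := gl_mem_of_generators (K := K) low hdiag swap g 1 one
  rwa [mul_one] at this

theorem swap_mul_elem_swap {ι : Type*} [Fintype ι] [DecidableEq ι] {a b : ι} (h : a ≠ b)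
    (t : Fˣ) : (perm (Equiv.swap a b) * elem b a (t : F) : GL ι F) =
      elem b a ((t⁻¹ : Fˣ) : F) * diag (coroot a b t ∘ Equiv.swap a b) *
        elem a b ((t⁻¹ : Fˣ) : F) := by
  rw [elem_swap h, diag_mul_perm, ← mul_assoc, ← mul_assoc, ← mul_assoc, swap_mul_elem,
    mul_assoc _ (perm _) (perm _), swap_mul_swap, mul_one]

theorem elem_mul_perm {ι : Type*} [Fintype ι] [DecidableEq ι] (a b : ι) (t : F)
    (σ : Equiv.Perm ι) :
    (elem a b t * perm σ : GL ι F) = perm σ * elem (σ⁻¹ a) (σ⁻¹ b) t := by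
  rw [perm_mul_elem]; simp

/-- The Bruhat decomposition relative to a pair of opposite Borel subgroups. -/
theorem exists_bruhat (g : GL (Fin n) F) : ∃ u ∈ lower n F, ∃ σ : Equiv.Perm (Fin n),
    ∃ h ∈ parabolic (fun i : Fin n => i), g = u * perm σ * h := by
  induction g using gl_induction with
  | one => exact ⟨1, one_mem _, 1, 1, one_mem _, by simp⟩
  | low v hv g ih =>
    obtain ⟨u, hu, σ, h, hh, rfl⟩ := ih
    exact ⟨v * u, mul_mem hv hu, σ, h, hh, by simp only [mul_assoc]⟩
  | hdiag d g ih =>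
    obtain ⟨u, hu, σ, h, hh, rfl⟩ := ih
    refine ⟨diag d * u * (diag d)⁻¹, conj_mem_unirad hu (diag_mem_parabolic _ _), σ,
      diag (d ∘ σ) * h, mul_mem (diag_mem_parabolic _ _) hh, ?_⟩
    rw [mul_assoc _ _ (_ * h), ← mul_assoc (perm σ), ← diag_mul_perm]
    group
  | swap a b hab g ih =>
    obtain ⟨u, hu, σ, h, hh, rfl⟩ := ih
    obtain ⟨v, t, -, hv, rfl⟩ := exists_lower_factor hab hu
    have hne : a ≠ b := by rintro rfl; simp at hab
    have hlt : a < b := by rw [Fin.lt_def]; omega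
    set s : GL (Fin n) F := perm (Equiv.swap a b) with hs
    have hss : s * s = 1 := swap_mul_swap a b
    have h1 : s * (v * elem b a t * perm σ * h) =
        s * v * s * (s * elem b a t) * perm σ * h := by
      rw [show s * v * s * (s * elem b a t) = s * v * (s * s) * elem b a t by
        simp only [mul_assoc], hss]
      simp only [mul_assoc, one_mul]
    rw [h1]
    rcases lt_or_ge (σ⁻¹ b) (σ⁻¹ a) with hσ | hσ
    · refine ⟨s * v * s, hv, Equiv.swap a b * σ, elem (σ⁻¹ b) (σ⁻¹ a) t * h,
        mul_mem (unirad_le_parabolic _ (elem_mem_upper hσ _)) hh, ?_⟩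
      rw [map_mul, ← hs]
      simp only [mul_assoc]
      rw [← mul_assoc (elem b a t), elem_mul_perm]
      simp only [mul_assoc]
    · by_cases ht : t = 0
      · refine ⟨s * v * s, hv, Equiv.swap a b * σ, h, hh, ?_⟩
        rw [ht, elem_zero, mul_one, map_mul, ← hs, mul_assoc _ s (perm σ)]
      · have hσ' : σ⁻¹ a < σ⁻¹ b := lt_of_le_of_ne hσ (by simpa using hne)
        obtain ⟨t, rfl⟩ : ∃ t' : Fˣ, t = t' := ⟨Units.mk0 t ht, rfl⟩
        refine ⟨s * v * s * elem b a ((t⁻¹ : Fˣ) : F), mul_mem hv (elem_mem_lower hlt _), σ,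
          diag ((coroot a b t ∘ Equiv.swap a b) ∘ σ) *
            elem (σ⁻¹ a) (σ⁻¹ b) ((t⁻¹ : Fˣ) : F) * h,
          mul_mem (mul_mem (diag_mem_parabolic _ _)
            (unirad_le_parabolic _ (elem_mem_upper hσ' _))) hh, ?_⟩
        rw [swap_mul_elem_swap hne]
        simp only [mul_assoc]
        congr 4
        rw [← mul_assoc (elem a b _), elem_mul_perm, ← mul_assoc (perm σ) (diag _),
          ← diag_mul_perm]
        simp only [mul_assoc]

end Bruhat

section FixedVectors

theorem isPGroup_upper {n p : ℕ} [Fact p.Prime] {F : Type*} [Field F] [CharP F p] :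
    IsPGroup p (upper n F) := by
  rintro ⟨g, hg⟩
  have hN : (g.val - 1) ^ n = 0 := by
    have ht : (g.val - 1).BlockTriangular id := fun i j hij => by
      rw [Matrix.sub_apply, hg i j hij.le, sub_self]
    have h := Matrix.aeval_self_charpoly (g.val - 1)
    rw [Matrix.charpoly_of_isUpperTriangular _ ht] at h
    simpa [upper_apply_self hg] using h
  obtain ⟨k, hk⟩ : ∃ k, n ≤ p ^ k :=
    ⟨n, (Nat.lt_pow_self (Fact.out : p.Prime).one_lt).le⟩
  refine ⟨k, Subtype.ext (Units.ext ?_)⟩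
  have hsub : (g.val - 1) ^ p ^ k = g.val ^ p ^ k - 1 ^ p ^ k := by
    rcases isEmpty_or_nonempty (Fin n) with h | h
    · exact Subsingleton.elim _ _
    · exact sub_pow_char_pow_of_commute _ _ (Commute.one_right _)
  rw [pow_eq_zero_of_le hk hN, one_pow] at hsub
  simpa using (sub_eq_zero.mp hsub.symm)

/-- A finite `p`-group acting on a nonzero space in characteristic `p` has a nonzero fixed
vector. -/
theorem exists_fixed_vector {G C V : Type*} [Group G] [Field C] [AddCommGroup V] [Module C V]
    {p : ℕ} [Fact p.Prime] [CharP C p] (ρ : Representation C G V) (H : Subgroup G) [Finite H]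
    (hH : IsPGroup p H) (W : Submodule C V) (hW : ∀ h ∈ H, ∀ w ∈ W, ρ h w ∈ W) (hne : W ≠ ⊥) :
    ∃ x ∈ W, x ≠ 0 ∧ ∀ h ∈ H, ρ h x = x := by
  obtain ⟨x, hxW, hx0⟩ := W.ne_bot_iff.mp hne
  let _ : Algebra (ZMod p) C := ZMod.algebra C p
  let _ : Module (ZMod p) V := Module.compHom V (algebraMap (ZMod p) C)
  have : IsScalarTower (ZMod p) C V := ⟨fun a c v => by
    rw [Algebra.smul_def, mul_smul]; rfl⟩
  let A : Submodule (ZMod p) V := Submodule.span (ZMod p) (Set.range fun h : H => ρ h x)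
  have hAW : A ≤ W.restrictScalars (ZMod p) := by
    rw [Submodule.span_le]
    rintro _ ⟨h, rfl⟩
    exact hW h h.2 x hxW
  have hA : ∀ h : H, ∀ a ∈ A, ρ h a ∈ A := fun h => by
    have : A ≤ A.comap ((ρ h).restrictScalars (ZMod p)) := by
      rw [Submodule.span_le]
      rintro _ ⟨k, rfl⟩
      refine Submodule.subset_span ⟨h * k, ?_⟩
      simp
    exact this
  have hfin : Module.Finite (ZMod p) A := Module.Finite.span_of_finite _ (Set.finite_range _)
  have : Finite A := Module.finite_of_finite (ZMod p)
  have hxA : x ∈ A := Submodule.subset_span ⟨1, by simp⟩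
  let _ : MulAction H A :=
    { smul := fun h a => ⟨ρ h a, hA h a a.2⟩
      one_smul := fun a => Subtype.ext (by change ρ (1 : H) a = a; simp)
      mul_smul := fun h k a => Subtype.ext (by
        change ρ (h * k : H) a = ρ h (ρ k a); simp) }
  have hdvd : p ∣ Nat.card A := by
    have : Nontrivial A := ⟨⟨⟨x, hxA⟩, 0, fun h => hx0 (congrArg Subtype.val h)⟩⟩
    rw [Module.natCard_eq_pow_finrank (K := ZMod p), Nat.card_zmod]
    exact dvd_pow_self _ Module.finrank_pos.ne'
  obtain ⟨y, hy, hy0⟩ := hH.exists_fixed_point_of_prime_dvd_card_of_fixed_point A hdvd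
    (a := 0) (fun h => Subtype.ext (map_zero (ρ h)))
  exact ⟨y, hAW y.2, fun h => hy0 (Subtype.ext h.symm), fun h hh =>
    congrArg Subtype.val (hy ⟨h, hh⟩)⟩

end FixedVectors

section Hecke

/-- Operators satisfying the braid relations and, on a stable set `E`, quadratic relations
`T² x ∈ C T x`, have a common eigenvector in `E`. -/
theorem exists_common_eigenvector_of_braid {C V : Type*} [Field C] [AddCommGroup V] [Module C V]
    (T : ℕ → V →ₗ[C] V) (E : Set V) (hE : ∀ i, ∀ x ∈ E, T i x ∈ E)
    (quad : ∀ i, ∀ x ∈ E, ∃ c : C, T i (T i x) = c • T i x)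
    (braid : ∀ i x, T i (T (i + 1) (T i x)) = T (i + 1) (T i (T (i + 1) x)))
    (comm : ∀ i j, i + 2 ≤ j → ∀ x, T i (T j x) = T j (T i x))
    (hne : ∃ x ∈ E, x ≠ 0) (k : ℕ) :
    ∃ x ∈ E, x ≠ 0 ∧ ∀ i < k, ∃ c : C, T i x = c • x := by
  induction k with
  | zero => simpa using hne
  | succ k ih =>
    obtain ⟨x, hxE, hx0, hx⟩ := ih
    have key : ∀ j ≤ k + 1, ∀ y ∈ E, y ≠ 0 → (∀ i, j ≤ i → i ≤ k → ∃ c : C, T i y = c • y) →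
        (∀ i, i + 1 < j → ∃ c : C, T i y = c • y) →
        (j ≤ k → ∀ i, i + 1 = j → ∃ w, y = T j w ∧ ∃ c : C, T i w = c • w) →
        ∃ x ∈ E, x ≠ 0 ∧ ∀ i < k + 1, ∃ c : C, T i x = c • x := by
      intro j
      induction j with
      | zero =>
        intro _ y hy hy0 h _ _
        exact ⟨y, hy, hy0, fun i hi => h i (Nat.zero_le _) (by omega)⟩
      | succ j ihj =>
        intro hj y hy hy0 hge hlt hw
        by_cases h0 : T j y = 0
        · refine ⟨y, hy, hy0, fun i hi => ?_⟩
          rcases lt_trichotomy i j with h | h | h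
          · exact hlt i (by omega)
          · exact ⟨0, by rw [h, h0, zero_smul]⟩
          · exact hge i (by omega) (by omega)
        · refine ihj (by omega) (T j y) (hE j y hy) h0 (fun i hji hik => ?_) (fun i hij => ?_)
            (fun _ i hi => ⟨y, rfl, hlt i (by omega)⟩)
          · rcases hji.eq_or_lt with h | h
            · exact h ▸ quad j y hy
            · rcases (Nat.succ_le_of_lt h).eq_or_lt with h' | h'
              · obtain rfl : j + 1 = i := h'
                obtain ⟨w, rfl, c, hc⟩ := hw hik j rfl
                exact ⟨c, by rw [← braid, hc, map_smul, map_smul]⟩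
              · obtain ⟨c, hc⟩ := hge i h hik
                exact ⟨c, by rw [← comm j i h', hc, map_smul]⟩
          · obtain ⟨c, hc⟩ := hlt i (by omega)
            exact ⟨c, by rw [comm i j (by omega), hc, map_smul]⟩
    exact key (k + 1) le_rfl x hxE hx0 (fun i h1 h2 => absurd h2 (by omega))
      (fun i hi => hx i (by omega)) (fun h => absurd h (by omega))

variable {ι F C V : Type*} [Fintype ι] [DecidableEq ι] [Field F] [Field C]
  [AddCommGroup V] [Module C V]

theorem rep_mul_apply {G C V : Type*} [Group G] [Field C] [AddCommGroup V] [Module C V]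
    (ρ : Representation C G V) (g h : G) (x : V) :
    ρ g (ρ h x) = ρ (g * h) x := by
  rw [map_mul]; rfl

theorem perm_mul_elem_mul (σ : Equiv.Perm ι) (a b : ι) (t : F) (g : GL ι F) :
    perm σ * (elem a b t * g) = elem (σ a) (σ b) t * (perm σ * g) := by
  rw [← mul_assoc, perm_mul_elem, mul_assoc]

variable [Fintype F]

/-- The Hecke operator attached to the reflection `swap a b`. -/
def heckeOp (ρ : Representation C (GL ι F) V) (a b : ι) : V →ₗ[C] V :=
  ∑ t : F, ρ (elem a b t * perm (Equiv.swap a b))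

theorem heckeOp_apply (ρ : Representation C (GL ι F) V) (a b : ι) (x : V) :
    heckeOp ρ a b x = ∑ t : F, ρ (elem a b t * perm (Equiv.swap a b)) x := by
  simp [heckeOp, LinearMap.sum_apply]

theorem heckeOp_comm (ρ : Representation C (GL ι F) V) {a b c d : ι} (hab : a ≠ b) (hcd : c ≠ d)
    (hac : a ≠ c) (had : a ≠ d) (hbc : b ≠ c) (hbd : b ≠ d) (x : V) :
    heckeOp ρ a b (heckeOp ρ c d x) = heckeOp ρ c d (heckeOp ρ a b x) := by
  simp only [heckeOp_apply, map_sum, rep_mul_apply]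
  rw [Finset.sum_comm]
  refine Finset.sum_congr rfl fun y _ => Finset.sum_congr rfl fun z _ => ?_
  congr 2
  have hperm : Equiv.swap a b * Equiv.swap c d = Equiv.swap c d * Equiv.swap a b := by
    ext i
    simp only [Equiv.Perm.mul_apply, Equiv.swap_apply_def]
    grind
  simp only [mul_assoc, perm_mul_elem_mul, Equiv.swap_apply_of_ne_of_ne hac.symm hbc.symm,
    Equiv.swap_apply_of_ne_of_ne had.symm hbd.symm, Equiv.swap_apply_of_ne_of_ne hac had,
    Equiv.swap_apply_of_ne_of_ne hbc hbd]
  rw [← map_mul, ← map_mul, hperm, ← mul_assoc, ← mul_assoc, elem_comm hab hcd hbc had]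

theorem heckeOp_braid (ρ : Representation C (GL ι F) V) {a b c : ι} (hab : a ≠ b) (hbc : b ≠ c)
    (hac : a ≠ c) (v : V) :
    heckeOp ρ a b (heckeOp ρ b c (heckeOp ρ a b v)) =
      heckeOp ρ b c (heckeOp ρ a b (heckeOp ρ b c v)) := by
  have hperm : Equiv.swap a b * Equiv.swap b c * Equiv.swap a b =
      Equiv.swap b c * Equiv.swap a b * Equiv.swap b c := by
    ext i
    simp only [Equiv.Perm.mul_apply, Equiv.swap_apply_def]
    grind
  have hperm' := congrArg (perm (ι := ι) (F := F)) hperm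
  simp only [map_mul] at hperm'
  have e1 : ∀ x y z : F, (elem a b x * perm (Equiv.swap a b) * (elem b c y *
      perm (Equiv.swap b c) * (elem a b z * perm (Equiv.swap a b))) : GL ι F) =
      elem a b x * elem a c y * elem b c z *
        (perm (Equiv.swap a b) * perm (Equiv.swap b c) * perm (Equiv.swap a b)) := by
    intro x y z
    simp only [mul_assoc, perm_mul_elem_mul, Equiv.swap_apply_left, Equiv.swap_apply_right,
      Equiv.swap_apply_of_ne_of_ne hac.symm hbc.symm, Equiv.swap_apply_of_ne_of_ne hab hac]
  have e2 : ∀ x y z : F, (elem b c x * perm (Equiv.swap b c) * (elem a b y *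
      perm (Equiv.swap a b) * (elem b c z * perm (Equiv.swap b c))) : GL ι F) =
      elem b c x * elem a c y * elem a b z *
        (perm (Equiv.swap a b) * perm (Equiv.swap b c) * perm (Equiv.swap a b)) := by
    intro x y z
    rw [hperm']
    simp only [mul_assoc, perm_mul_elem_mul, Equiv.swap_apply_left, Equiv.swap_apply_right,
      Equiv.swap_apply_of_ne_of_ne hac.symm hbc.symm, Equiv.swap_apply_of_ne_of_ne hab hac]
  have e3 : ∀ x y z : F, (elem a b x * elem a c y * elem b c z : GL ι F) =
      elem b c z * elem a c (y + x * z) * elem a b x := by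
    intro x y z
    rw [elem_comm hab hac hab.symm hac, mul_assoc, elem_comm_heisenberg hab hbc hac, mul_assoc,
      elem_comm hab hac hab.symm hac, ← mul_assoc, ← mul_assoc, elem_comm hac hbc hbc.symm hac,
      mul_assoc (elem b c z), elem_mul_elem_same]
  simp only [heckeOp_apply, map_sum, rep_mul_apply, e1, e2, e3]
  have shift : ∀ x z : F, ∑ y : F, ρ (elem b c z * elem a c (y + x * z) * elem a b x *
      (perm (Equiv.swap a b) * perm (Equiv.swap b c) * perm (Equiv.swap a b))) v =
      ∑ y : F, ρ (elem b c z * elem a c y * elem a b x *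
      (perm (Equiv.swap a b) * perm (Equiv.swap b c) * perm (Equiv.swap a b))) v := fun x z =>
    Fintype.sum_equiv (Equiv.addRight (x * z)) _ _ fun _ => rfl
  rw [Finset.sum_congr rfl fun x _ => Finset.sum_comm, Finset.sum_comm]
  refine Finset.sum_congr rfl fun z _ => ?_
  rw [Finset.sum_congr rfl fun x _ => shift z x, Finset.sum_comm]

end Hecke

section HighestVector

variable {n : ℕ} {F C V : Type*} [Field F] [Field C] [AddCommGroup V] [Module C V]

/-- Torus eigenvectors fixed by the upper unitriangular group. -/
def borelEigen (ρ : Representation C (GL (Fin n) F) V) : Set V :=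
  {x | (∀ u ∈ upper n F, ρ u x = x) ∧ ∀ d, ∃ c : C, ρ (diag d) x = c • x}

variable [Fintype F]

theorem heckeOp_mem_borelEigen (ρ : Representation C (GL (Fin n) F) V) {a b : Fin n}
    (hab : a.val + 1 = b.val) {x : V} (hx : x ∈ borelEigen ρ) :
    heckeOp ρ a b x ∈ borelEigen ρ := by
  refine ⟨fun u hu => ?_, fun d => ?_⟩
  · rw [heckeOp_apply, map_sum]
    refine Fintype.sum_equiv (Equiv.addRight (u.val a b)) _ _ fun t => ?_
    obtain ⟨h, hh, he⟩ := upper_mul_elem hab hu t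
    have : u * (elem a b t * perm (Equiv.swap a b)) = elem a b (t + u.val a b) *
        perm (Equiv.swap a b) * (perm (Equiv.swap a b) * h * perm (Equiv.swap a b)) := by
      rw [← mul_assoc, he, ← mul_assoc, ← mul_assoc, mul_assoc (elem a b _) (perm _) (perm _),
        swap_mul_swap, mul_one]
    rw [rep_mul_apply, this, ← rep_mul_apply, hx.1 _ hh]
    rfl
  · obtain ⟨c, hc⟩ := hx.2 (d ∘ Equiv.swap a b)
    refine ⟨c, ?_⟩
    rw [heckeOp_apply, map_sum, Finset.smul_sum]
    refine Fintype.sum_equiv (Units.mulLeft (d a * (d b)⁻¹)) _ _ fun t => ?_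
    have : diag d * (elem a b t * perm (Equiv.swap a b)) =
        elem a b (((d a * (d b)⁻¹ : Fˣ) : F) * t) * perm (Equiv.swap a b) *
          diag (d ∘ Equiv.swap a b) := by
      rw [← mul_assoc, diag_mul_elem, mul_assoc, diag_mul_perm, ← mul_assoc]
      congr 3
      push_cast
      ring
    rw [rep_mul_apply, this, ← rep_mul_apply, hc, map_smul]
    rfl

theorem heckeOp_sq (hq : (Fintype.card F : C) = 0) (ρ : Representation C (GL (Fin n) F) V)
    {a b : Fin n} (hab : a.val + 1 = b.val) {x : V} (hx : x ∈ borelEigen ρ) :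
    ∃ c : C, heckeOp ρ a b (heckeOp ρ a b x) = c • heckeOp ρ a b x := by
  have hne : a ≠ b := by rintro rfl; simp at hab
  have hlt : a < b := by rw [Fin.lt_def]; omega
  have key : ∀ r : F, ∃ c : C, ∑ t : F, ρ (elem a b t * perm (Equiv.swap a b) *
      (elem a b r * perm (Equiv.swap a b))) x = c • heckeOp ρ a b x := by
    intro r
    by_cases hr : r = 0
    · refine ⟨0, ?_⟩
      have : ∀ t : F, ρ (elem a b t * perm (Equiv.swap a b) *
          (elem a b r * perm (Equiv.swap a b))) x = x := fun t => by
        rw [hr, elem_zero, one_mul, mul_assoc, swap_mul_swap, mul_one, hx.1 _ (elem_mem_upper hlt _)]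
      simp only [this, Finset.sum_const, Finset.card_univ, zero_smul]
      rw [← Nat.cast_smul_eq_nsmul C, hq, zero_smul]
    · obtain ⟨r, rfl⟩ : ∃ r' : Fˣ, r = r' := ⟨Units.mk0 r hr, rfl⟩
      obtain ⟨c, hc⟩ := hx.2 (coroot a b r ∘ Equiv.swap a b)
      refine ⟨c, ?_⟩
      rw [heckeOp_apply, Finset.smul_sum]
      refine Fintype.sum_equiv (Equiv.addRight ((r⁻¹ : Fˣ) : F)) _ _ fun t => ?_
      have : (elem a b t * perm (Equiv.swap a b) *
          (elem a b (r : F) * perm (Equiv.swap a b)) : GL (Fin n) F) =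
          elem a b (t + ((r⁻¹ : Fˣ) : F)) * perm (Equiv.swap a b) *
            diag (coroot a b r ∘ Equiv.swap a b) * elem a b ((r⁻¹ : Fˣ) : F) := by
        rw [mul_assoc, ← mul_assoc (perm _) (elem _ _ _), swap_mul_elem, mul_assoc, swap_mul_swap,
          mul_one, elem_swap hne, ← elem_mul_elem_same, diag_mul_perm]
        simp only [mul_assoc]
      rw [this, ← rep_mul_apply, ← rep_mul_apply, hx.1 _ (elem_mem_upper hlt _), hc, map_smul]
      rfl
  choose c hc using key
  refine ⟨∑ r, c r, ?_⟩
  rw [heckeOp_apply ρ a b (heckeOp ρ a b x)]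
  simp only [heckeOp_apply ρ a b x, map_sum, rep_mul_apply]
  rw [Finset.sum_comm]
  simp only [hc, Finset.sum_smul, heckeOp_apply]

/-- A nonzero finite-dimensional space stable under the torus has a torus eigenvector. -/
theorem exists_torus_eigenvector [IsAlgClosed C] [FiniteDimensional C V]
    {ι : Type*} [Fintype ι] [DecidableEq ι]
    (ρ : Representation C (GL ι F) V) (W : Submodule C V)
    (hW : ∀ d, ∀ x ∈ W, ρ (diag d) x ∈ W) (hne : W ≠ ⊥) :
    ∃ x ∈ W, x ≠ 0 ∧ ∀ d, ∃ c : C, ρ (diag d) x = c • x := by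
  induction h : Module.finrank C W using Nat.strong_induction_on generalizing W with
  | _ k ih =>
    by_cases hall : ∀ d, ∃ c : C, ∀ x ∈ W, ρ (diag d) x = c • x
    · obtain ⟨x, hx, hx0⟩ := W.ne_bot_iff.mp hne
      refine ⟨x, hx, hx0, fun d => ?_⟩
      obtain ⟨c, hc⟩ := hall d
      exact ⟨c, hc x hx⟩
    · push Not at hall
      obtain ⟨d, hd⟩ := hall
      have : Nontrivial W := W.nontrivial_iff_ne_bot.mpr hne
      obtain ⟨c, hc⟩ := Module.End.exists_eigenvalue ((ρ (diag d)).restrict (hW d))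
      obtain ⟨y, hy⟩ := hc.exists_hasEigenvector
      let W' := W ⊓ LinearMap.ker (ρ (diag d) - c • LinearMap.id)
      have hmem : ∀ x, x ∈ W' ↔ x ∈ W ∧ ρ (diag d) x = c • x := fun x => by
        simp [W', sub_eq_zero]
      obtain ⟨z, hz, hzc⟩ := hd c
      have hlt : W' < W := lt_of_le_of_ne inf_le_left fun he =>
        hzc ((hmem z).mp (he ▸ hz)).2
      have hW' : W' ≠ ⊥ := by
        rw [Submodule.ne_bot_iff]
        refine ⟨y, (hmem _).mpr ⟨y.2, congrArg Subtype.val hy.apply_eq_smul⟩,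
          fun h => hy.2 (Subtype.ext h)⟩
      obtain ⟨x, hx, h0, hx'⟩ := ih _ (h ▸ Submodule.finrank_lt_finrank_of_lt hlt) W'
        (fun e x hx => by
          rw [hmem] at hx ⊢
          refine ⟨hW e x hx.1, ?_⟩
          rw [rep_mul_apply, ← map_mul, mul_comm, map_mul, ← rep_mul_apply, hx.2, map_smul])
        hW' rfl
      exact ⟨x, hlt.le hx, h0, hx'⟩

theorem exists_hecke_eigenvector {p : ℕ} [Fact p.Prime] [CharP F p] [CharP C p] [IsAlgClosed C]
    [FiniteDimensional C V] [Nontrivial V] (hq : (Fintype.card F : C) = 0)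
    (ρ : Representation C (GL (Fin n) F) V) :
    ∃ v ∈ borelEigen ρ, v ≠ 0 ∧
      ∀ a b : Fin n, a.val + 1 = b.val → ∃ c : C, heckeOp ρ a b v = c • v := by
  have hE : ∃ x ∈ borelEigen ρ, x ≠ 0 := by
    let W : Submodule C V :=
      { carrier := {x | ∀ u ∈ upper n F, ρ u x = x}
        add_mem' := fun hx hy u hu => by rw [map_add, hx u hu, hy u hu]
        zero_mem' := fun u _ => map_zero _
        smul_mem' := fun c x hx u hu => by rw [map_smul, hx u hu] }
    obtain ⟨x, -, hx0, hx⟩ := exists_fixed_vector (p := p) ρ (upper n F) isPGroup_upper ⊤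
      (fun _ _ _ _ => trivial) top_ne_bot
    obtain ⟨y, hy, hy0, hyd⟩ := exists_torus_eigenvector ρ W (fun d x hx u hu => by
      have := hx _ (conj_mem_unirad hu (inv_mem (diag_mem_parabolic _ d)))
      rw [inv_inv] at this
      conv_rhs => rw [← this, rep_mul_apply]
      rw [rep_mul_apply]
      congr 2
      group) (W.ne_bot_iff.mpr ⟨x, hx, hx0⟩)
    exact ⟨y, ⟨hy, hyd⟩, hy0⟩
  let T : ℕ → V →ₗ[C] V := fun i =>
    if h : i + 1 < n then heckeOp ρ ⟨i, by omega⟩ ⟨i + 1, h⟩ else 0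
  have hT : ∀ i (h : i + 1 < n), T i = heckeOp ρ ⟨i, by omega⟩ ⟨i + 1, h⟩ := fun i h => dif_pos h
  have hT0 : ∀ i, ¬ i + 1 < n → T i = 0 := fun i h => dif_neg h
  obtain ⟨v, hv, hv0, hTv⟩ := exists_common_eigenvector_of_braid T (borelEigen ρ)
    (fun i x hx => by
      by_cases h : i + 1 < n
      · rw [hT i h]; exact heckeOp_mem_borelEigen ρ rfl hx
      · rw [hT0 i h]; exact ⟨fun _ _ => map_zero _, fun _ => ⟨0, by simp⟩⟩)
    (fun i x hx => by
      by_cases h : i + 1 < n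
      · rw [hT i h]; exact heckeOp_sq hq ρ rfl hx
      · rw [hT0 i h]; exact ⟨0, by simp⟩)
    (fun i x => by
      by_cases h : i + 1 + 1 < n
      · rw [hT i (by omega), hT (i + 1) h]
        exact heckeOp_braid ρ (by simp) (by simp) (by simp; omega) x
      · rw [hT0 (i + 1) h]; simp)
    (fun i j hij x => by
      by_cases h : j + 1 < n
      · rw [hT i (by omega), hT j h]
        refine heckeOp_comm ρ ?_ ?_ ?_ ?_ ?_ ?_ x <;> simp <;> omega
      · rw [hT0 j h]; simp)
    hE n
  refine ⟨v, hv, hv0, fun a b hab => ?_⟩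
  obtain ⟨c, hc⟩ := hTv a a.2
  refine ⟨c, ?_⟩
  rw [← hc, hT a (by omega)]
  congr 2
  exact Fin.ext hab.symm

theorem span_lower_eq_top (ρ : Representation C (GL (Fin n) F) V)
    (hirr : ∀ S : Submodule C V, (∀ g, ∀ v ∈ S, ρ g v ∈ S) → S = ⊥ ∨ S = ⊤)
    {v : V} (hv : v ∈ borelEigen ρ) (hv0 : v ≠ 0)
    (hT : ∀ a b : Fin n, a.val + 1 = b.val → ∃ c : C, heckeOp ρ a b v = c • v) :
    Submodule.span C {x | ∃ u ∈ lower n F, x = ρ u v} = ⊤ := by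
  set S := Submodule.span C {x | ∃ u ∈ lower n F, x = ρ u v} with hS
  have hmem : ∀ u ∈ lower n F, ρ u v ∈ S := fun u hu => Submodule.subset_span ⟨u, hu, rfl⟩
  have stab : ∀ g, (∀ u ∈ lower n F, ρ (g * u) v ∈ S) → ∀ x ∈ S, ρ g x ∈ S := by
    intro g hg
    have : S ≤ S.comap (ρ g) := by
      rw [hS, Submodule.span_le, ← hS]
      rintro _ ⟨u, hu, rfl⟩
      simpa only [SetLike.mem_coe, Submodule.mem_comap, rep_mul_apply] using hg u hu
    exact this
  have hlow : ∀ g ∈ lower n F, ∀ x ∈ S, ρ g x ∈ S := fun g hg =>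
    stab g fun u hu => hmem _ (mul_mem hg hu)
  refine (hirr S fun g => ?_).resolve_left ?_
  · induction g using gl_induction with
    | one => intro x hx; simpa using hx
    | low u hu g ih =>
      intro x hx
      rw [← rep_mul_apply]
      exact hlow u hu _ (ih x hx)
    | hdiag d g ih =>
      intro x hx
      rw [← rep_mul_apply]
      refine stab _ (fun u hu => ?_) _ (ih x hx)
      obtain ⟨c, hc⟩ := hv.2 d
      have : diag d * u = diag d * u * (diag d)⁻¹ * diag d := by group
      rw [this, ← rep_mul_apply, hc, map_smul]
      exact S.smul_mem _ (hmem _ (conj_mem_unirad hu (diag_mem_parabolic _ _)))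
    | swap a b hab g ih =>
      intro x hx
      rw [← rep_mul_apply]
      refine stab _ (fun u hu => ?_) _ (ih x hx)
      have hne : a ≠ b := by rintro rfl; simp at hab
      have hlt : a < b := by rw [Fin.lt_def]; omega
      obtain ⟨h, t, -, hh, rfl⟩ := exists_lower_factor hab hu
      have h1 : perm (Equiv.swap a b) * (h * elem b a t) =
          perm (Equiv.swap a b) * h * perm (Equiv.swap a b) *
            (perm (Equiv.swap a b) * elem b a t) := by
        rw [mul_assoc _ (perm _) (perm _ * _), ← mul_assoc (perm _) (perm _) (elem _ _ _),
          swap_mul_swap, one_mul, mul_assoc]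
      rw [h1, ← rep_mul_apply]
      refine hlow _ hh _ ?_
      have hunit : ∀ t : F, t ≠ 0 → ρ (perm (Equiv.swap a b) * elem b a t) v ∈ S := by
        intro t ht
        obtain ⟨t, rfl⟩ : ∃ t' : Fˣ, t = t' := ⟨Units.mk0 t ht, rfl⟩
        obtain ⟨c, hc⟩ := hv.2 (coroot a b t ∘ Equiv.swap a b)
        rw [swap_mul_elem_swap hne, ← rep_mul_apply, hv.1 _ (elem_mem_upper hlt _),
          ← rep_mul_apply, hc, map_smul]
        exact S.smul_mem _ (hmem _ (elem_mem_lower hlt _))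
      by_cases ht : t = 0
      · obtain ⟨c, hc⟩ := hT a b hab
        have hsum : ∑ t : F, ρ (perm (Equiv.swap a b) * elem b a t) v = c • v := by
          rw [← hc, heckeOp_apply]
          refine Finset.sum_congr rfl fun t _ => ?_
          rw [elem_mul_perm]; simp
        have hvS : v ∈ S := by simpa using hmem 1 (one_mem _)
        classical
        rw [ht]
        rw [← Finset.add_sum_erase _ _ (Finset.mem_univ (0 : F))] at hsum
        rw [eq_sub_of_add_eq hsum]
        exact S.sub_mem (S.smul_mem _ hvS) (S.sum_mem fun t ht =>
          hunit t (Finset.ne_of_mem_erase ht))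
      · exact hunit t ht
  · refine S.ne_bot_iff.mpr ?_
    exact ⟨v, by simpa using hmem 1 (one_mem _), hv0⟩

end HighestVector

section HighestWeightPair

variable {n : ℕ} {F C V : Type*} [Field F] [Field C] [AddCommGroup V] [Module C V]

theorem finiteDimensional_of_irreducible {G : Type*} [Group G] [Finite G] [Nontrivial V]
    (ρ : Representation C G V)
    (hirr : ∀ S : Submodule C V, (∀ g, ∀ v ∈ S, ρ g v ∈ S) → S = ⊥ ∨ S = ⊤) :
    FiniteDimensional C V := by
  obtain ⟨v, hv⟩ := exists_ne (0 : V)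
  let S := Submodule.span C (Set.range fun g => ρ g v)
  have hS : S = ⊤ := by
    refine (hirr S fun g => ?_).resolve_left (S.ne_bot_iff.mpr
      ⟨v, Submodule.subset_span ⟨1, by simp⟩, hv⟩)
    have : S ≤ S.comap (ρ g) := by
      refine Submodule.span_le.mpr ?_
      rintro _ ⟨h, rfl⟩
      exact Submodule.subset_span ⟨g * h, by simp⟩
    exact this
  have : FiniteDimensional C S := FiniteDimensional.span_of_finite C (Set.finite_range _)
  rw [hS] at this
  exact Module.finite_def.mpr (Module.Finite.iff_fg.mp this)

/-- The dual of a representation, twisted by transposition. -/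
def trDual (ρ : Representation C (GL (Fin n) F) V) :
    Representation C (GL (Fin n) F) (Module.Dual C V) where
  toFun g := (ρ (tr g)).dualMap
  map_one' := by rw [tr_one, map_one]; rfl
  map_mul' g h := by rw [tr_mul, map_mul]; rfl

theorem trDual_apply (ρ : Representation C (GL (Fin n) F) V) (g : GL (Fin n) F)
    (φ : Module.Dual C V) (x : V) : trDual ρ g φ x = φ (ρ (tr g) x) := rfl

theorem trDual_irreducible [FiniteDimensional C V] (ρ : Representation C (GL (Fin n) F) V)
    (hirr : ∀ S : Submodule C V, (∀ g, ∀ v ∈ S, ρ g v ∈ S) → S = ⊥ ∨ S = ⊤)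
    (S : Submodule C (Module.Dual C V)) (hS : ∀ g, ∀ φ ∈ S, trDual ρ g φ ∈ S) :
    S = ⊥ ∨ S = ⊤ := by
  rw [← Subspace.dualCoannihilator_dualAnnihilator_eq (W := S)]
  rcases hirr S.dualCoannihilator (fun g x hx => by
    rw [Submodule.mem_dualCoannihilator] at hx ⊢
    intro φ hφ
    have := hx _ (hS (tr g) φ hφ)
    rwa [trDual_apply, tr_tr] at this) with h | h
  · right; rw [h, Submodule.dualAnnihilator_bot]
  · left; rw [h, Submodule.dualAnnihilator_top]

variable [Fintype F]

/-- A highest weight vector together with a functional invariant under the opposite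
unipotent group. -/
structure IsHighestWeightPair (ρ : Representation C (GL (Fin n) F) V) (v : V)
    (μ : Module.Dual C V) : Prop where
  ne_zero : v ≠ 0
  upper_apply : ∀ u ∈ upper n F, ρ u v = v
  diag_apply : ∀ d, ∃ c : C, ρ (diag d) v = c • v
  hecke : ∀ a b : Fin n, a.val + 1 = b.val → ∃ c : C, heckeOp ρ a b v = c • v
  span_eq_top : Submodule.span C {x | ∃ u ∈ lower n F, x = ρ u v} = ⊤
  lower_apply : ∀ u ∈ lower n F, ∀ x, μ (ρ u x) = μ x
  eq_zero : ∀ x, (∀ u ∈ upper n F, μ (ρ u x) = 0) → x = 0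

theorem exists_isHighestWeightPair {p : ℕ} [Fact p.Prime] [CharP F p] [CharP C p]
    [IsAlgClosed C] [Nontrivial V] (hq : (Fintype.card F : C) = 0)
    (ρ : Representation C (GL (Fin n) F) V)
    (hirr : ∀ S : Submodule C V, (∀ g, ∀ v ∈ S, ρ g v ∈ S) → S = ⊥ ∨ S = ⊤) :
    ∃ v μ, IsHighestWeightPair ρ v μ := by
  have := finiteDimensional_of_irreducible ρ hirr
  obtain ⟨v, hv, hv0, hTv⟩ := exists_hecke_eigenvector (p := p) hq ρ
  obtain ⟨μ, hμ, hμ0, hTμ⟩ := exists_hecke_eigenvector (p := p) hq (trDual ρ)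
  refine ⟨v, μ, hv0, hv.1, hv.2, hTv, span_lower_eq_top ρ hirr hv hv0 hTv, fun u hu x => ?_,
    fun x hx => ?_⟩
  · have := congrArg (fun φ => φ x) (hμ.1 (tr u) (tr_mem_unirad.mpr hu))
    simpa only [trDual_apply, tr_tr] using this
  · rw [← Module.forall_dual_apply_eq_zero_iff C]
    intro φ
    have hφ : φ ∈ Submodule.span C {ψ | ∃ u ∈ lower n F, ψ = trDual ρ u μ} := by
      rw [span_lower_eq_top (trDual ρ) (trDual_irreducible ρ hirr) hμ hμ0 hTμ]
      trivial
    induction hφ using Submodule.span_induction with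
    | mem ψ h =>
      obtain ⟨u, hu, rfl⟩ := h
      exact hx _ (tr_mem_unirad.mpr hu)
    | zero => rfl
    | add φ ψ _ _ h1 h2 => rw [LinearMap.add_apply, h1, h2, add_zero]
    | smul c φ _ h => rw [LinearMap.smul_apply, h, smul_zero]

namespace IsHighestWeightPair

variable {ρ : Representation C (GL (Fin n) F) V} {v : V} {μ : Module.Dual C V}

theorem dual_apply_ne_zero (h : IsHighestWeightPair ρ v μ) : μ v ≠ 0 := fun h0 => by
  have hμ : ∀ x, μ x = 0 := fun x => by
    have hx : x ∈ Submodule.span C {x | ∃ u ∈ lower n F, x = ρ u v} := h.span_eq_top ▸ trivial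
    induction hx using Submodule.span_induction with
    | mem ψ hu =>
      obtain ⟨u, hu, rfl⟩ := hu
      rw [h.lower_apply u hu, h0]
    | zero => exact map_zero μ
    | add x y _ _ h1 h2 => rw [map_add, h1, h2, add_zero]
    | smul c x _ h => rw [map_smul, h, smul_zero]
  exact h.ne_zero (h.eq_zero v fun _ _ => hμ _)

theorem eq_zero_of_fixed (h : IsHighestWeightPair ρ v μ) {x : V}
    (hx : ∀ u ∈ upper n F, ρ u x = x) (h0 : μ x = 0) : x = 0 :=
  h.eq_zero x fun u hu => by rw [hx u hu, h0]

theorem eq_smul_of_fixed (h : IsHighestWeightPair ρ v μ) {x : V}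
    (hx : ∀ u ∈ upper n F, ρ u x = x) : x = ((μ v)⁻¹ * μ x) • v := by
  rw [← sub_eq_zero]
  refine h.eq_zero_of_fixed (fun u hu => ?_) ?_
  · rw [map_sub, map_smul, hx u hu, h.upper_apply u hu]
  · rw [map_sub, map_smul, smul_eq_mul, mul_right_comm, inv_mul_cancel₀ h.dual_apply_ne_zero,
      one_mul, sub_self]

theorem dual_diag_apply (h : IsHighestWeightPair ρ v μ) {d : Fin n → Fˣ} {c : C}
    (hc : ρ (diag d) v = c • v) (x : V) : μ (ρ (diag d) x) = c * μ x := by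
  have hx : x ∈ Submodule.span C {x | ∃ u ∈ lower n F, x = ρ u v} := h.span_eq_top ▸ trivial
  induction hx using Submodule.span_induction with
  | mem ψ hu =>
    obtain ⟨u, hu, rfl⟩ := hu
    have : diag d * u = diag d * u * (diag d)⁻¹ * diag d := by group
    rw [rep_mul_apply, this, ← rep_mul_apply, hc,
      h.lower_apply _ (conj_mem_unirad hu (diag_mem_parabolic _ _)), map_smul,
      h.lower_apply u hu, smul_eq_mul]
  | zero => simp
  | add x y _ _ h1 h2 => rw [map_add, map_add, h1, h2, map_add, mul_add]
  | smul e x _ h => rw [map_smul, map_smul, h, map_smul, smul_eq_mul, smul_eq_mul, mul_left_comm]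

end IsHighestWeightPair

end HighestWeightPair

section Weyl

theorem sum_eq_add_sum_units {F M : Type*} [Field F] [Fintype F] [AddCommMonoid M] (f : F → M) :
    ∑ t, f t = f 0 + ∑ᶠ t : Fˣ, f t := by
  classical
  rw [Fintype.sum_eq_add_sum_subtype_ne f 0, finsum_eq_sum_of_fintype]
  congr 1
  exact (Fintype.sum_equiv unitsEquivNeZero _ _ fun _ => rfl).symm

theorem perm_induction {n : ℕ} {P : Equiv.Perm (Fin n) → Prop} (one : P 1)
    (step : ∀ σ (a b : Fin n), a.val + 1 = b.val → σ b < σ a → P (σ * Equiv.swap a b) → P σ)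
    (σ : Equiv.Perm (Fin n)) : P σ := by
  induction h : toLex (σ : Fin n → Fin n) using WellFoundedLT.induction generalizing σ with
  | _ x ih =>
  subst h
  by_cases hdesc : ∃ a b : Fin n, a.val + 1 = b.val ∧ σ b < σ a
  · obtain ⟨a, b, hab, hlt⟩ := hdesc
    refine step σ a b hab hlt (ih _ ⟨a, fun j hj => ?_, ?_⟩ _ rfl)
    · have hjb : j ≠ b := by rintro rfl; exact absurd (Fin.lt_def.mp hj) (by omega)
      simp [Equiv.swap_apply_of_ne_of_ne hj.ne hjb]
    · simpa using hlt
  · push Not at hdesc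
    have hmono : StrictMono σ := by
      obtain _ | n := n
      · exact fun i => i.elim0
      · exact Fin.strictMono_iff_lt_succ.mpr fun i => lt_of_le_of_ne (hdesc _ _ (by simp))
          fun h => absurd (σ.injective h) (Fin.castSucc_lt_succ).ne
    have : σ = 1 := by
      have := Subsingleton.elim (hmono.orderIsoOfSurjective σ σ.surjective) (OrderIso.refl _)
      ext i
      exact congrArg (fun e : Fin n ≃o Fin n => (e i).val) this
    exact this ▸ one

namespace IsHighestWeightPair

variable {n : ℕ} {F C V : Type*} [Field F] [Field C] [AddCommGroup V] [Module C V] [Fintype F]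
  {ρ : Representation C (GL (Fin n) F) V} {v : V} {μ : Module.Dual C V}

theorem exists_sum_swap_elem (h : IsHighestWeightPair ρ v μ) {a b : Fin n}
    (hab : a.val + 1 = b.val) : ∃ c : C,
      ∑ t : F, ρ (perm (Equiv.swap a b)) (ρ (elem b a t) v) = c • v := by
  obtain ⟨c, hc⟩ := h.hecke a b hab
  refine ⟨c, ?_⟩
  rw [← hc, heckeOp_apply]
  refine Finset.sum_congr rfl fun t _ => ?_
  rw [elem_mul_perm, rep_mul_apply]
  simp

theorem swap_elem_apply (h : IsHighestWeightPair ρ v μ) {a b : Fin n}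
    (hab : a.val + 1 = b.val) (t : Fˣ) {c : C}
    (hc : ρ (diag (coroot a b t ∘ Equiv.swap a b)) v = c • v) :
    ρ (perm (Equiv.swap a b)) (ρ (elem b a (t : F)) v) = c • ρ (elem b a ((t⁻¹ : Fˣ) : F)) v := by
  have hne : a ≠ b := by rintro rfl; simp at hab
  have hlt : a < b := by rw [Fin.lt_def]; omega
  rw [rep_mul_apply, swap_mul_elem_swap hne, ← rep_mul_apply,
    h.upper_apply _ (elem_mem_upper hlt _), ← rep_mul_apply, hc, map_smul]

theorem exists_swap_apply_eq_sum (h : IsHighestWeightPair ρ v μ) {a b : Fin n}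
    (hab : a.val + 1 = b.val) : ∃ α : F → C,
      ρ (perm (Equiv.swap a b)) v = ∑ t, α t • ρ (elem b a t) v := by
  suffices h' : ρ (perm (Equiv.swap a b)) v ∈
      Submodule.span C (Set.range fun t : F => ρ (elem b a t) v) by
    obtain ⟨α, hα⟩ := (Submodule.mem_span_range_iff_exists_fun C).mp h'
    exact ⟨α, hα.symm⟩
  obtain ⟨c, hc⟩ := h.exists_sum_swap_elem hab
  rw [sum_eq_add_sum_units, elem_zero, map_one, Module.End.one_apply] at hc
  rw [eq_sub_of_add_eq hc]
  refine Submodule.sub_mem _ (Submodule.smul_mem _ _ (Submodule.subset_span ⟨0, ?_⟩)) ?_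
  · simp [elem_zero]
  · have := Fintype.ofFinite Fˣ
    rw [finsum_eq_sum_of_fintype]
    refine Submodule.sum_mem _ fun t _ => ?_
    obtain ⟨e, he⟩ := h.diag_apply (coroot a b t ∘ Equiv.swap a b)
    rw [h.swap_elem_apply hab t he]
    exact Submodule.smul_mem _ _ (Submodule.subset_span ⟨_, rfl⟩)

theorem diag_swap_apply (h : IsHighestWeightPair ρ v μ) {a b : Fin n}
    (h0 : μ (ρ (perm (Equiv.swap a b)) v) ≠ 0) {d : Fin n → Fˣ} {c : C}
    (hc : ρ (diag d) v = c • v) : ρ (diag (d ∘ Equiv.swap a b)) v = c • v := by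
  obtain ⟨e, he⟩ := h.diag_apply (d ∘ Equiv.swap a b)
  have h1 := h.dual_diag_apply hc (ρ (perm (Equiv.swap a b)) v)
  rw [rep_mul_apply, diag_mul_perm, ← rep_mul_apply, he, map_smul, map_smul, smul_eq_mul] at h1
  rw [he, mul_right_cancel₀ h0 h1]

theorem diag_coroot_apply (h : IsHighestWeightPair ρ v μ) {a b : Fin n} (hne : a ≠ b)
    (h0 : μ (ρ (perm (Equiv.swap a b)) v) ≠ 0) {c : C}
    (hc : ρ (diag (Pi.mulSingle a (-1))) v = c • v) (t : Fˣ) :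
    ρ (diag (coroot a b t ∘ Equiv.swap a b)) v = c • v := by
  refine h.diag_swap_apply h0 ?_
  obtain ⟨e, he⟩ := h.diag_apply (Pi.mulSingle a t)
  obtain ⟨e', he'⟩ := h.diag_apply (Pi.mulSingle a t⁻¹)
  have hee : e * e' = 1 := by
    have h1 : Pi.mulSingle a t * Pi.mulSingle a t⁻¹ = (1 : Fin n → Fˣ) := by
      rw [← Pi.mulSingle_mul, mul_inv_cancel, Pi.mulSingle_one]
    have h2 : ρ (diag (Pi.mulSingle a t * Pi.mulSingle a t⁻¹)) v = (e * e') • v := by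
      rw [map_mul, ← rep_mul_apply, he', map_smul, he, smul_smul, mul_comm]
    rw [h1, map_one, map_one, Module.End.one_apply] at h2
    refine (smul_left_injective C h.ne_zero ?_).symm
    simpa using h2
  have hs : coroot a b t = Pi.mulSingle a (-1) *
      ((Pi.mulSingle a t ∘ Equiv.swap a b) * Pi.mulSingle a t⁻¹) := by
    ext i
    simp only [coroot, Pi.mulSingle_apply, Function.update_apply, Equiv.swap_apply_def, Pi.mul_apply,
      Function.comp_apply]
    by_cases h1 : i = a
    · subst h1; simp [hne.symm]
    · by_cases h2 : i = b
      · subst h2; simp [h1]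
      · simp [h1, h2]
  rw [hs, map_mul diag, map_mul diag, ← rep_mul_apply, ← rep_mul_apply, he', map_smul,
    h.diag_swap_apply h0 he, map_smul, map_smul, hc, smul_smul, smul_smul, mul_comm e' e, hee,
    one_mul]

/-- The rank-one case: if the functional does not vanish on `s v`, then `s v` is a multiple
of `v`. -/
theorem swap_apply_eq_smul (h : IsHighestWeightPair ρ v μ) (hq : (Fintype.card F : C) = 0)
    {a b : Fin n} (hab : a.val + 1 = b.val) (h0 : μ (ρ (perm (Equiv.swap a b)) v) ≠ 0) :
    ∃ c : C, ρ (perm (Equiv.swap a b)) v = c • v := by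
  have hne : a ≠ b := by rintro rfl; simp at hab
  have hlt : a < b := by rw [Fin.lt_def]; omega
  have hss : ∀ x, ρ (perm (Equiv.swap a b)) (ρ (perm (Equiv.swap a b)) x) = x := fun x => by
    rw [rep_mul_apply, swap_mul_swap, map_one, Module.End.one_apply]
  obtain ⟨c, hc⟩ := h.exists_sum_swap_elem hab
  have hc0 : c = 0 := by
    have h1 := congrArg (fun x => μ (ρ (perm (Equiv.swap a b)) x)) hc
    simp only [map_sum, hss, map_smul, h.lower_apply _ (elem_mem_lower hlt _),
      Finset.sum_const, Finset.card_univ, smul_eq_mul, nsmul_eq_mul, hq, zero_mul] at h1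
    exact (mul_eq_zero.mp h1.symm).resolve_right h0
  rw [hc0, zero_smul] at hc
  have hsum : ∑ t : F, ρ (elem b a t) v = 0 := by
    have := congrArg (ρ (perm (Equiv.swap a b))) hc
    simpa only [map_sum, hss, map_zero] using this
  obtain ⟨e, he⟩ := h.diag_apply (Pi.mulSingle a (-1))
  refine ⟨e, ?_⟩
  have := Fintype.ofFinite Fˣ
  rw [sum_eq_add_sum_units, finsum_eq_sum_of_fintype, elem_zero, map_one,
    Module.End.one_apply] at hc hsum
  have hcs : ∑ t : Fˣ, ρ (perm (Equiv.swap a b)) (ρ (elem b a (t : F)) v) =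
      e • ∑ t : Fˣ, ρ (elem b a (t : F)) v := by
    rw [Finset.smul_sum]
    refine Fintype.sum_equiv (Equiv.inv Fˣ) _ _ fun t => ?_
    rw [h.swap_elem_apply hab t (h.diag_coroot_apply hne h0 he t)]
    rfl
  rw [hcs, eq_neg_of_add_eq_zero_right hsum, smul_neg, ← sub_eq_add_neg] at hc
  exact sub_eq_zero.mp hc

theorem perm_apply_eq_smul (h : IsHighestWeightPair ρ v μ) (hq : (Fintype.card F : C) = 0)
    (σ : Equiv.Perm (Fin n)) (h0 : μ (ρ (perm σ) v) ≠ 0) :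
    ∃ c : C, ρ (perm σ) v = c • v := by
  induction σ using perm_induction with
  | one => exact ⟨1, by simp⟩
  | step σ a b hab hσ ih =>
    have hss : ∀ x, ρ (perm (Equiv.swap a b)) (ρ (perm (Equiv.swap a b)) x) = x := fun x => by
      rw [rep_mul_apply, swap_mul_swap, map_one, Module.End.one_apply]
    have hlt : a < b := by rw [Fin.lt_def]; omega
    obtain ⟨α, hα⟩ := h.exists_swap_apply_eq_sum hab
    have h1 : μ (ρ (perm (Equiv.swap a b)) v) = (∑ t, α t) * μ v := by
      rw [hα, map_sum, Finset.sum_mul]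
      refine Finset.sum_congr rfl fun t _ => ?_
      rw [map_smul, h.lower_apply _ (elem_mem_lower hlt _), smul_eq_mul]
    have h2 : μ (ρ (perm σ) v) = (∑ t, α t) * μ (ρ (perm (σ * Equiv.swap a b)) v) := by
      rw [← hss v]
      conv_lhs => rw [hα]
      rw [hss, map_sum, map_sum, map_sum, Finset.sum_mul]
      refine Finset.sum_congr rfl fun t _ => ?_
      have : perm σ * (perm (Equiv.swap a b) * elem b a t) =
          elem (σ a) (σ b) t * perm (σ * Equiv.swap a b) := by
        rw [map_mul, ← mul_assoc (elem _ _ _), ← perm_mul_elem, mul_assoc, perm_mul_elem]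
        simp
      rw [map_smul, map_smul, map_smul, rep_mul_apply, rep_mul_apply, mul_assoc, this, ← rep_mul_apply,
        h.lower_apply _ (elem_mem_lower hσ _), smul_eq_mul]
    rw [h2] at h0
    have hα0 := left_ne_zero_of_mul h0
    obtain ⟨c, hc⟩ := ih (right_ne_zero_of_mul h0)
    obtain ⟨e, he⟩ := h.swap_apply_eq_smul hq hab
      (by rw [h1]; exact mul_ne_zero hα0 h.dual_apply_ne_zero)
    refine ⟨e * c, ?_⟩
    rw [map_mul, ← rep_mul_apply, he, map_smul] at hc
    have he' : v = (e * e) • v := by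
      conv_lhs => rw [← hss v, he, map_smul, he, smul_smul]
    conv_lhs => rw [he']
    rw [map_smul, mul_smul, hc, smul_smul]

end IsHighestWeightPair

end Weyl

section Coinvariants

variable {n : ℕ} {F C V : Type*} [Field F] [Field C] [AddCommGroup V] [Module C V]

/-- The kernel of the projection of `V` onto its `H`-coinvariants. -/
def coinvKer {G : Type*} [Group G] (ρ : Representation C G V) (H : Subgroup G) : Submodule C V :=
  Submodule.span C {x | ∃ g ∈ H, ∃ v, x = ρ g v - v}

theorem apply_sub_self_mem_coinvKer {G : Type*} [Group G] (ρ : Representation C G V)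
    {H : Subgroup G} {g : G} (hg : g ∈ H) (v : V) : ρ g v - v ∈ coinvKer ρ H :=
  Submodule.subset_span ⟨g, hg, v, rfl⟩

theorem apply_mem_coinvKer {G : Type*} [Group G] (ρ : Representation C G V) {H : Subgroup G}
    {g : G} (hg : ∀ h ∈ H, g * h * g⁻¹ ∈ H) {x : V} (hx : x ∈ coinvKer ρ H) :
    ρ g x ∈ coinvKer ρ H := by
  have : coinvKer ρ H ≤ (coinvKer ρ H).comap (ρ g) := by
    refine Submodule.span_le.mpr ?_
    rintro _ ⟨h, hh, v, rfl⟩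
    have := apply_sub_self_mem_coinvKer ρ (hg h hh) (ρ g v)
    rw [rep_mul_apply, inv_mul_cancel_right, ← rep_mul_apply] at this
    rwa [SetLike.mem_coe, Submodule.mem_comap, map_sub]
  exact this hx

/-- The block diagonal subgroup attached to `b`. -/
def levi (b : Fin n → ℕ) : Subgroup (GL (Fin n) F) :=
  parabolic b ⊓ parabolic fun i => OrderDual.toDual (b i)

theorem mem_levi_of_ne {b : Fin n → ℕ} {m : GL (Fin n) F}
    (hm : ∀ i j, b i ≠ b j → m.val i j = 0) : m ∈ levi b :=
  ⟨fun i j hij => hm i j hij.ne', fun i j hij => hm i j (OrderDual.toDual_lt_toDual.mp hij).ne⟩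

theorem exists_eq_diag {m : GL (Fin n) F} (hm : ∀ i j, i ≠ j → m.val i j = 0) :
    ∃ d, m = diag d := by
  have h0 : ∀ i, m.val i i ≠ 0 := fun i hi => by
    have h : (m * m⁻¹).val i i = 1 := by rw [mul_inv_cancel]; simp
    rw [Units.val_mul, Matrix.mul_apply, Finset.sum_eq_zero] at h
    · exact zero_ne_one h
    · intro j _
      by_cases hij : i = j
      · rw [← hij, hi, zero_mul]
      · rw [hm i j hij, zero_mul]
  refine ⟨fun i => Units.mk0 _ (h0 i), Units.ext ?_⟩
  ext i j
  rw [coe_diag, Matrix.diagonal_apply]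
  split_ifs with h
  · subst h; rfl
  · exact hm i j h

theorem lower_le_parabolic {b : Fin n → ℕ} (hb : Monotone b) :
    lower n F ≤ parabolic fun i => OrderDual.toDual (b i) :=
  (unirad_le_parabolic _).trans <| parabolic_mono fun _ _ hij =>
    OrderDual.toDual_lt_toDual.mpr (hb.reflect_lt (OrderDual.toDual_lt_toDual.mp hij))

theorem upper_le_parabolic {b : Fin n → ℕ} (hb : Monotone b) : upper n F ≤ parabolic b :=
  (unirad_le_parabolic _).trans <| parabolic_mono fun _ _ hij => hb.reflect_lt hij

namespace IsHighestWeightPair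

variable [Fintype F] {ρ : Representation C (GL (Fin n) F) V} {v : V} {μ : Module.Dual C V}
  {b : Fin n → ℕ}

theorem dual_eq_zero_of_mem_coinvKer (h : IsHighestWeightPair ρ v μ) (hb : Monotone b) {x : V}
    (hx : x ∈ coinvKer ρ (unirad fun i => OrderDual.toDual (b i))) : μ x = 0 := by
  have : coinvKer ρ (unirad fun i => OrderDual.toDual (b i)) ≤ LinearMap.ker μ := by
    refine Submodule.span_le.mpr ?_
    rintro _ ⟨g, hg, w, rfl⟩
    have hg' : g ∈ lower n F :=
      unirad_mono (b := fun i => OrderDual.toDual (b i)) (c := fun i : Fin n => OrderDual.toDual i)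
        (fun _ _ hij => OrderDual.toDual_le_toDual.mpr (hb (OrderDual.toDual_le_toDual.mp hij))) hg
    rw [SetLike.mem_coe, LinearMap.mem_ker, map_sub, h.lower_apply g hg', sub_self]
  exact this hx

theorem exists_levi_dual_ne_zero {p : ℕ} [Fact p.Prime] [CharP F p] [CharP C p]
    (h : IsHighestWeightPair ρ v μ) (hb : Monotone b) {y : V}
    (hy : y ∉ coinvKer ρ (unirad fun i => OrderDual.toDual (b i))) :
    ∃ m ∈ levi b, μ (ρ m y) ≠ 0 := by
  set K := coinvKer ρ (unirad fun i => OrderDual.toDual (b i)) with hK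
  by_contra! hcon
  let X := Submodule.span C {x | ∃ m ∈ levi b, x = ρ m v}
  have hKlevi : ∀ m ∈ levi b, ∀ x ∈ K, ρ m x ∈ K := fun m hm x hx =>
    apply_mem_coinvKer ρ (fun k hk => conj_mem_unirad hk hm.2) hx
  have hXlevi : ∀ m ∈ levi b, ∀ x ∈ X, ρ m x ∈ X := fun m hm => by
    have : X ≤ X.comap (ρ m) := by
      refine Submodule.span_le.mpr ?_
      rintro _ ⟨m', hm', rfl⟩
      exact Submodule.subset_span ⟨m * m', mul_mem hm hm', rep_mul_apply _ _ _ _⟩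
    exact this
  have hXfix : ∀ k ∈ unirad b, ∀ x ∈ X, ρ k x = x := fun k hk => by
    have : X ≤ LinearMap.eqLocus (ρ k) LinearMap.id := by
      refine Submodule.span_le.mpr ?_
      rintro _ ⟨m, hm, rfl⟩
      have hk' : m⁻¹ * k * m ∈ upper n F := by
        refine unirad_mono (b := b) (c := fun i : Fin n => i) (fun i j hij => hb hij) ?_
        simpa using conj_mem_unirad hk (inv_mem hm.1)
      have he : k * m = m * (m⁻¹ * k * m) := by group
      rw [SetLike.mem_coe, LinearMap.mem_eqLocus, LinearMap.id_apply, rep_mul_apply, he,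
        ← rep_mul_apply, h.upper_apply _ hk']
    exact this
  have hsup : X ⊔ K = ⊤ := by
    rw [eq_top_iff, ← h.span_eq_top, Submodule.span_le]
    rintro _ ⟨u, hu, rfl⟩
    have hu' := lower_le_parabolic hb hu
    obtain ⟨m, k, hm, hk, rfl⟩ := exists_levi_mul_unirad hu'
    have hm' : m ∈ levi b := mem_levi_of_ne fun i j hij => hm i j fun he => hij he
    have he : ρ (m * k) v = ρ m v + (ρ (m * k * m⁻¹) (ρ m v) - ρ m v) := by
      rw [rep_mul_apply, inv_mul_cancel_right]; abel
    rw [he]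
    exact Submodule.add_mem_sup (Submodule.subset_span ⟨m, hm', rfl⟩)
      (apply_sub_self_mem_coinvKer ρ (conj_mem_unirad hk hm'.2) _)
  let Z : Submodule C V :=
    { carrier := {x | x ∈ X ∧ ∀ m ∈ levi b, μ (ρ m x) = 0}
      add_mem' := fun hx hy => ⟨X.add_mem hx.1 hy.1, fun m hm => by
        rw [map_add, map_add, hx.2 m hm, hy.2 m hm, add_zero]⟩
      zero_mem' := ⟨X.zero_mem, fun m _ => by rw [map_zero, map_zero]⟩
      smul_mem' := fun c x hx => ⟨X.smul_mem c hx.1, fun m hm => by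
        rw [map_smul, map_smul, hx.2 m hm, smul_zero]⟩ }
  have hZ : Z = ⊥ := by
    by_contra hne
    obtain ⟨x, hx, hx0, hfix⟩ := exists_fixed_vector (p := p) ρ (upper n F) isPGroup_upper Z
      (fun u hu x hx => by
        obtain ⟨m, k, hm, hk, rfl⟩ := exists_levi_mul_unirad (upper_le_parabolic hb hu)
        have hm' := mem_levi_of_ne hm
        rw [← rep_mul_apply, hXfix k hk x hx.1]
        refine ⟨hXlevi m hm' x hx.1, fun m' hm'' => ?_⟩
        rw [rep_mul_apply]
        exact hx.2 _ (mul_mem hm'' hm')) hne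
    refine hx0 (h.eq_zero_of_fixed hfix ?_)
    simpa using hx.2 1 (one_mem _)
  obtain ⟨x, hx, w, hw, rfl⟩ := Submodule.mem_sup.mp (hsup ▸ Submodule.mem_top : y ∈ X ⊔ K)
  have hxZ : x ∈ Z := ⟨hx, fun m hm => by
    have h1 := hcon m hm
    rwa [map_add, map_add, h.dual_eq_zero_of_mem_coinvKer hb (hKlevi m hm w hw), add_zero] at h1⟩
  rw [hZ, Submodule.mem_bot] at hxZ
  rw [hxZ, zero_add] at hy
  exact hy hw

theorem borel_apply (h : IsHighestWeightPair ρ v μ) {g : GL (Fin n) F}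
    (hg : g ∈ parabolic fun i : Fin n => i) : ∃ c : C, ρ g v = c • v := by
  obtain ⟨m, u, hm, hu, rfl⟩ := exists_levi_mul_unirad hg
  obtain ⟨d, rfl⟩ := exists_eq_diag hm
  rw [← rep_mul_apply, h.upper_apply u hu]
  exact h.diag_apply d

theorem not_mem_coinvKer_iff {p : ℕ} [Fact p.Prime] [CharP F p] [CharP C p]
    (h : IsHighestWeightPair ρ v μ) (hq : (Fintype.card F : C) = 0) (hb : Monotone b)
    (g : GL (Fin n) F) :
    ρ g v ∉ coinvKer ρ (unirad fun i => OrderDual.toDual (b i)) ↔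
      ∃ x ∈ parabolic fun i => OrderDual.toDual (b i), ∃ y, (∃ c : C, ρ y v = c • v) ∧
        g = x * y := by
  constructor
  · intro hg
    obtain ⟨m, hm, hmg⟩ := h.exists_levi_dual_ne_zero (p := p) hb hg
    obtain ⟨u, hu, σ, k, hk, he⟩ := exists_bruhat (m * g)
    obtain ⟨c, hc⟩ := h.borel_apply hk
    rw [rep_mul_apply, he, ← rep_mul_apply, ← rep_mul_apply, h.lower_apply u hu, hc, map_smul,
      map_smul, smul_eq_mul] at hmg
    obtain ⟨e, he'⟩ := h.perm_apply_eq_smul hq σ (right_ne_zero_of_mul hmg)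
    have hu' := lower_le_parabolic hb hu
    refine ⟨m⁻¹ * u, mul_mem (inv_mem hm.2) hu', perm σ * k, ⟨c * e, ?_⟩, ?_⟩
    · rw [← rep_mul_apply, hc, map_smul, he', smul_smul]
    · rw [mul_assoc, ← mul_assoc u, ← he, inv_mul_cancel_left]
  · rintro ⟨x, hx, y, ⟨c, hc⟩, rfl⟩ hmem
    have hmem' := apply_mem_coinvKer ρ (g := x⁻¹)
      (fun k hk => conj_mem_unirad hk (inv_mem hx)) hmem
    rw [rep_mul_apply, inv_mul_cancel_left, hc] at hmem'
    have h0 := h.dual_eq_zero_of_mem_coinvKer hb hmem'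
    rw [map_smul, smul_eq_mul] at h0
    have hc0 := (mul_eq_zero.mp h0).resolve_right h.dual_apply_ne_zero
    rw [hc0, zero_smul] at hc
    refine h.ne_zero ?_
    have := congrArg (ρ y⁻¹) hc
    rwa [rep_mul_apply, inv_mul_cancel, map_one, Module.End.one_apply, map_zero] at this

end IsHighestWeightPair

end Coinvariants

end GLRep

/-!
STATEMENT 11.  `G = GL_n(F_q)` (`q` a power of the prime `p`), `C` algebraically closed of
characteristic `p`, `V` an irreducible `C`-representation of `G`.  A composition of `n` is
encoded by a monotone block function `b : Fin n → ℕ`; it determines the standard parabolic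
`P` (block upper triangular), its Levi `M`, unipotent radical `N`, the opposite parabolic
`P̄ = M N̄`.  `U` is the full upper unitriangular subgroup, `V^U` the `U`-fixed vectors,
`V_{N̄}` the `N̄`-coinvariants, `P_V` the stabilizer of the subspace `V^U`.

Claim: for `g ∈ G`, the image of `g·V^U` in `V_{N̄}` is nonzero iff `g ∈ P̄ · P_V`.
-/
theorem statement11 (p : ℕ) (hp : p.Prime) (q r : ℕ) (hr : 0 < r) (hq : q = p ^ r)
    (𝔽 : Type) [Field 𝔽] [Fintype 𝔽] (hcard : Fintype.card 𝔽 = q)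
    (C : Type) [Field C] [IsAlgClosed C] (hC : CharP C p)
    (n : ℕ) (hn : 1 ≤ n)
    (V : Type) [AddCommGroup V] [Module C V] [Nontrivial V]
    (ρ : Representation C (GL (Fin n) 𝔽) V)
    (hirr : ∀ S : Submodule C V, (∀ (g : GL (Fin n) 𝔽) (v : V), v ∈ S → ρ g v ∈ S) →
      S = ⊥ ∨ S = ⊤)
    (b : Fin n → ℕ) (hb : Monotone b) :
    -- the full upper unitriangular subgroup U
    let U : Set (GL (Fin n) 𝔽) :=
      {g | (∀ i j : Fin n, j < i → (↑g : Matrix (Fin n) (Fin n) 𝔽) i j = 0) ∧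
        ∀ i : Fin n, (↑g : Matrix (Fin n) (Fin n) 𝔽) i i = 1}
    -- the opposite parabolic P̄ (block lower triangular)
    let Pbar : Set (GL (Fin n) 𝔽) :=
      {g | ∀ i j : Fin n, b i < b j → (↑g : Matrix (Fin n) (Fin n) 𝔽) i j = 0}
    -- the opposite unipotent radical N̄ (block lower unitriangular)
    let Nbar : Set (GL (Fin n) 𝔽) :=
      {g | (∀ i j : Fin n, b i < b j → (↑g : Matrix (Fin n) (Fin n) 𝔽) i j = 0) ∧
        ∀ i j : Fin n, b i = b j →
          (↑g : Matrix (Fin n) (Fin n) 𝔽) i j = if i = j then (1 : 𝔽) else 0}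
    -- V^U
    let fixU : Submodule C V :=
      { carrier := {v | ∀ g ∈ U, ρ g v = v}
        add_mem' := by intro v w hv hw g hg; rw [map_add, hv g hg, hw g hg]
        zero_mem' := by intro g hg; rw [map_zero]
        smul_mem' := by intro c v hv g hg; rw [_root_.map_smul, hv g hg] }
    -- the subspace of V defining the coinvariants V_{N̄} = V / coinvN
    let coinvN : Submodule C V :=
      Submodule.span C {x | ∃ g ∈ Nbar, ∃ v : V, x = ρ g v - v}
    -- P_V, the stabilizer of V^U
    let PV : Set (GL (Fin n) 𝔽) :=
      {g | Submodule.map (ρ g : V →ₗ[C] V) fixU = fixU}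
    ∀ g : GL (Fin n) 𝔽,
      (∃ v ∈ fixU, Submodule.Quotient.mk (p := coinvN) (ρ g v) ≠ 0) ↔
      ∃ x ∈ Pbar, ∃ y ∈ PV, g = x * y := by
  have := Fact.mk hp
  have : CharP 𝔽 p := charP_of_card_eq_prime_pow (hcard.trans hq)
  have hq0 : (Fintype.card 𝔽 : C) = 0 := by
    rw [hcard, hq, Nat.cast_pow, CharP.cast_eq_zero, zero_pow hr.ne']
  obtain ⟨v, μ, h⟩ := GLRep.exists_isHighestWeightPair (p := p) hq0 ρ hirr
  intro U Pbar Nbar fixU coinvN PV g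
  have hU : ∀ u, u ∈ U ↔ u ∈ GLRep.upper n 𝔽 := fun u => by
    refine ⟨fun hu i j hij => ?_, fun hu => ⟨fun i j hij => ?_, fun i => ?_⟩⟩
    · rcases hij.eq_or_lt with rfl | hlt
      · rw [hu.2, Matrix.one_apply_eq]
      · rw [hu.1 i j hlt, Matrix.one_apply_ne hlt.ne']
    · rw [hu i j hij.le, Matrix.one_apply_ne hij.ne']
    · rw [hu i i le_rfl, Matrix.one_apply_eq]
  have hN : ∀ u, u ∈ Nbar ↔ u ∈ GLRep.unirad fun i => OrderDual.toDual (b i) := fun u => by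
    refine ⟨fun hu i j hij => ?_, fun hu => ⟨fun i j hij => ?_, fun i j hij => ?_⟩⟩
    · rcases (OrderDual.toDual_le_toDual.mp hij).eq_or_lt with he | hlt
      · rw [hu.2 i j he, Matrix.one_apply]
      · rw [hu.1 i j hlt, Matrix.one_apply_ne (fun he => hlt.ne (congrArg b he))]
    · rw [hu i j (OrderDual.toDual_le_toDual.mpr hij.le),
        Matrix.one_apply_ne (fun he => hij.ne (congrArg b he))]
    · rw [hu i j (OrderDual.toDual_le_toDual.mpr hij.le), Matrix.one_apply]
  have hcoinv : coinvN = GLRep.coinvKer ρ (GLRep.unirad fun i => OrderDual.toDual (b i)) := by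
    simp only [coinvN, GLRep.coinvKer, hN]
  have hfix : ∀ x, x ∈ fixU ↔ ∃ c : C, x = c • v := fun x => by
    refine ⟨fun hx => ⟨_, h.eq_smul_of_fixed fun u hu => hx u ((hU u).mpr hu)⟩, ?_⟩
    rintro ⟨c, rfl⟩
    exact fixU.smul_mem c fun u hu => h.upper_apply u ((hU u).mp hu)
  have hPV : ∀ y, y ∈ PV ↔ ∃ c : C, ρ y v = c • v := fun y => by
    constructor
    · intro hy
      exact (hfix _).mp (hy ▸ Submodule.mem_map_of_mem ((hfix v).mpr ⟨1, (one_smul C v).symm⟩))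
    · rintro ⟨c, hc⟩
      have hc0 : c ≠ 0 := fun h0 => h.ne_zero (by
        have := congrArg (ρ y⁻¹) hc
        rwa [GLRep.rep_mul_apply, inv_mul_cancel, map_one, Module.End.one_apply, h0, zero_smul,
          map_zero] at this)
      refine le_antisymm ?_ fun x hx => ?_
      · rintro _ ⟨x, hx, rfl⟩
        obtain ⟨e, rfl⟩ := (hfix x).mp hx
        exact (hfix _).mpr ⟨e * c, by rw [_root_.map_smul, hc, smul_smul]⟩
      · obtain ⟨e, rfl⟩ := (hfix x).mp hx
        refine ⟨(e * c⁻¹) • v, (hfix _).mpr ⟨_, rfl⟩, ?_⟩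
        rw [_root_.map_smul, hc, smul_smul, inv_mul_cancel_right₀ hc0]
  have hP : ∀ x, x ∈ Pbar ↔ x ∈ GLRep.parabolic fun i => OrderDual.toDual (b i) :=
    fun x => ⟨fun hx i j hij => hx i j (OrderDual.toDual_lt_toDual.mp hij),
      fun hx i j hij => hx (OrderDual.toDual_lt_toDual.mpr hij)⟩
  have hmain := h.not_mem_coinvKer_iff (p := p) hq0 hb g
  simp only [hP, hPV]
  rw [← hmain, ← hcoinv]
  simp only [ne_eq, Submodule.Quotient.mk_eq_zero]
  constructor
  · rintro ⟨x, hx, hgx⟩ hgv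
    obtain ⟨c, rfl⟩ := (hfix x).mp hx
    exact hgx (by rw [_root_.map_smul]; exact coinvN.smul_mem c hgv)
  · exact fun hg => ⟨v, (hfix v).mpr ⟨1, (one_smul C v).symm⟩, hg⟩
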